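/- arXiv:1602.08900 — 2 statements merged into one kernel-verified Lean document; each statement's English description precedes it below -/
import Mathlib

section
/- Fix J > 0 and h > 0. For every ε > 0 there exists N such that for all n ≥ N and every non-decreasing degree sequence d_1 ≤ ⋯ ≤ d_n with 3 ≤ d_i ≤ √n for all i and ℓ_n = d_1+⋯+d_n even, writing ℓ_m = d_1+⋯+d_m, m̃ = min{ 1 ≤ m ≤ n : ℓ_m ≥ ℓ_n/2 } and d̄ = ℓ_n/n, the energy barrier of the Configuration Model satisfies P[ Γ*_n ≥ J·I_{d̄}(1/2)·ℓ_n − h·m̃ − ε·n ] ≥ 1 − ε. -/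
/-- Spin value of a Boolean: `+1` for `true`, `−1` for `false`. -/
def spin (b : Bool) : ℝ := if b then 1 else -1

/-- The product of the spins at the two endpoints of an unoriented edge. -/
noncomputable def edgeEnergy {V : Type*} (σ : V → Bool) : Sym2 V → ℝ :=
  Sym2.lift ⟨fun v w => spin (σ v) * spin (σ w), fun v w => by ring⟩

/-- The Hamiltonian `H(σ) = −(J/2)·Σ_{(v,w)∈E} σ(v)σ(w) − (h/2)·Σ_v σ(v)` of a
multigraph with edge multiset `E` (edges counted with multiplicity). -/
noncomputable def hamiltonian {V : Type*} [Fintype V] (J h : ℝ)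
    (E : Multiset (Sym2 V)) (σ : V → Bool) : ℝ :=
  -(J/2) * (E.map (edgeEnergy σ)).sum - (h/2) * ∑ v, spin (σ v)

/-- Two spin configurations differ at exactly one vertex. -/
def IsFlipStep {V : Type*} [DecidableEq V] (σ τ : V → Bool) : Prop :=
  ∃ v, τ = Function.update σ v (! σ v)

/-- The communication height `Φ(ξ,ζ)`: the minimum over paths `γ : ξ → ζ` of
single spin-flips of the maximal energy along the path. -/
noncomputable def commHeight {V : Type*} [Fintype V] [DecidableEq V]
    (H : (V → Bool) → ℝ) (ξ ζ : V → Bool) : ℝ :=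
  sInf { M : ℝ | ∃ (k : ℕ) (γ : Fin (k+1) → (V → Bool)),
    γ 0 = ξ ∧ γ (Fin.last k) = ζ ∧
    (∀ i : Fin k, IsFlipStep (γ i.castSucc) (γ i.succ)) ∧
    M = Finset.univ.sup' ⟨0, Finset.mem_univ 0⟩ (fun i => H (γ i)) }

/-- The energy barrier `Γ* = Φ(⊟,⊞) − H(⊟)` of an energy landscape `H` on spin
configurations. -/
noncomputable def gammaStar {V : Type*} [Fintype V] [DecidableEq V]
    (H : (V → Bool) → ℝ) : ℝ :=
  commHeight H (fun _ => false) (fun _ => true) - H (fun _ => false)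

/-- The perfect matchings of the stub set `S = {(i,j) : 1 ≤ i ≤ n, 1 ≤ j ≤ d_i}`
of a degree sequence `d`: fixed-point-free involutions of `Σ i, Fin (d i)`.
Each such matching determines a multigraph of the Configuration Model. -/
def cmMatchings (n : ℕ) (d : Fin n → ℕ) :
    Finset ((Σ i : Fin n, Fin (d i)) → (Σ i : Fin n, Fin (d i))) :=
  Finset.univ.filter (fun ξ => (∀ s, ξ (ξ s) = s) ∧ ∀ s, ξ s ≠ s)

/-- The Hamiltonian of the Configuration Model multigraph determined by a stub
matching `ξ`:
`H(σ) = −(J/2)·Σ_{matched pairs {(i,j),(i',j')}} σ(i)σ(i') − (h/2)·Σ_i σ(i)`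
(each matched pair is counted twice in the sum over stubs, whence `J/4`). -/
noncomputable def cmHamiltonian (n : ℕ) (d : Fin n → ℕ) (J h : ℝ)
    (ξ : (Σ i : Fin n, Fin (d i)) → (Σ i : Fin n, Fin (d i)))
    (σ : Fin n → Bool) : ℝ :=
  -(J/4) * ∑ s : Σ i : Fin n, Fin (d i), spin (σ s.1) * spin (σ (ξ s).1)
    - (h/2) * ∑ i, spin (σ i)

/-- `ellPart n d m = ℓ_m = d_1 + ⋯ + d_m`, the total degree of the first `m`
vertices. -/
def ellPart (n : ℕ) (d : Fin n → ℕ) (m : ℕ) : ℕ :=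
  ∑ i : Fin n, if (i : ℕ) < m then d i else 0

/-- `Idelta δ x` : for real `δ > 1` and `x ∈ (0, 1/2]`,
`I_δ(x) = inf{ y : 0 < y ≤ x and
  1 < x^{x(1−1/δ)}·(1−x)^{(1−x)(1−1/δ)}·(1−x−y)^{−(1−x−y)/2}·(x−y)^{−(x−y)/2}·y^{−y} }`. -/
noncomputable def Idelta (δ x : ℝ) : ℝ :=
  sInf {y : ℝ | 0 < y ∧ y ≤ x ∧
    1 < x ^ (x * (1 - 1/δ)) * (1 - x) ^ ((1 - x) * (1 - 1/δ)) *
        (1 - x - y) ^ (-(1 - x - y)/2) * (x - y) ^ (-(x - y)/2) * y ^ (-y)}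

/-- The number of points whose image under `ξ` lies on the other side of the bipartition `B`;
for an involution `ξ` this is twice the number of matched pairs cut by `B`. -/
def cutCount {S : Type*} [Fintype S] (ξ : S → S) (B : S → Bool) : ℕ :=
  (Finset.univ.filter (fun s => B s ≠ B (ξ s))).card

/-- The fixed-point-free involutions of a finite type. -/
def fpfInvolutions (S : Type*) [Fintype S] [DecidableEq S] : Finset (S → S) :=
  Finset.univ.filter (fun ξ => (∀ s, ξ (ξ s) = s) ∧ ∀ s, ξ s ≠ s)

theorem exists_prod_bool_equiv {S : Type*} [Finite S] (ξ : S → S)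
    (h1 : ∀ s, ξ (ξ s) = s) (h2 : ∀ s, ξ s ≠ s) :
    ∃ (R : Set S) (e : R × Bool ≃ S), ∀ r b, ξ (e (r, b)) = e (r, !b) := by
  obtain ⟨N, ⟨f⟩⟩ := Finite.exists_equiv_fin S
  let R : Set S := {s | f s < f (ξ s)}
  let g : R × Bool → S := fun p => if p.2 then ξ p.1 else p.1
  have hg : Function.Bijective g := by
    constructor
    · rintro ⟨⟨r, hr⟩, b⟩ ⟨⟨r', hr'⟩, b'⟩ hrr
      simp only [R, Set.mem_ofPred_eq] at hr hr'
      cases b <;> cases b' <;> simp only [g, if_true, Bool.false_eq_true, if_false] at hrr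
      · subst hrr; rfl
      · subst hrr; rw [h1] at hr; exact absurd hr hr'.not_gt
      · subst hrr; rw [h1] at hr'; exact absurd hr hr'.not_gt
      · have := congrArg ξ hrr
        rw [h1, h1] at this
        subst this; rfl
    · intro s
      rcases lt_trichotomy (f s) (f (ξ s)) with hs | hs | hs
      · exact ⟨(⟨s, hs⟩, false), by simp [g]⟩
      · exact absurd (f.injective hs).symm (h2 s)
      · exact ⟨(⟨ξ s, by simpa [R, h1] using hs⟩, true), by simp [g, h1]⟩
  refine ⟨R, Equiv.ofBijective g hg, ?_⟩
  intro r b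
  cases b <;> simp [g, h1]

theorem fpfInvolutions_nonempty {S : Type*} [Fintype S] [DecidableEq S] (a : ℕ)
    (hS : Fintype.card S = 2 * a) : (fpfInvolutions S).Nonempty := by
  have e : S ≃ Fin a × Bool := Fintype.equivOfCardEq (by simp [hS, mul_comm])
  refine ⟨fun s => e.symm ((e s).1, !(e s).2), ?_⟩
  simp only [fpfInvolutions, Finset.mem_filter, Finset.mem_univ, true_and]
  refine ⟨by simp, ?_⟩
  intro s hs
  have := congrArg (fun s => (e s).2) hs
  simp at this

theorem sum_pow_cutCount {S : Type*} [Fintype S] [DecidableEq S] {ξ : S → S} (a : ℕ)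
    (hS : Fintype.card S = 2 * a) (hξ : ξ ∈ fpfInvolutions S) (p q : ℝ) :
    ∑ B : S → Bool, p ^ cutCount ξ B * q ^ (2 * a - cutCount ξ B) =
      (2 * p ^ 2 + 2 * q ^ 2) ^ a := by
  classical
  simp only [fpfInvolutions, Finset.mem_filter, Finset.mem_univ, true_and] at hξ
  obtain ⟨R, e, he⟩ := exists_prod_bool_equiv ξ hξ.1 hξ.2
  have hR : Fintype.card R = a := by
    have := Fintype.card_congr e
    rw [hS, Fintype.card_prod, Fintype.card_bool] at this
    omega
  have hprod : ∀ B : S → Bool, p ^ cutCount ξ B * q ^ (2 * a - cutCount ξ B) =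
      ∏ s, (if B s ≠ B (ξ s) then p else q) := by
    intro B
    rw [Finset.prod_ite, Finset.prod_const, Finset.prod_const, ← hS, cutCount]
    congr 2
    have := Finset.card_filter_add_card_filter_not (s := (Finset.univ : Finset S))
      (fun s => B s ≠ B (ξ s))
    rw [Finset.card_univ] at this
    omega
  let E : (S → Bool) ≃ (R → Bool → Bool) :=
    (Equiv.arrowCongr e.symm (Equiv.refl Bool)).trans (Equiv.curry R Bool Bool)
  have hE : ∀ B r b, E B r b = B (e (r, b)) := fun B r b => rfl
  let w : (Bool → Bool) → ℝ := fun φ => ∏ b, (if φ b ≠ φ (!b) then p else q)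
  have h3 : ∀ B : S → Bool, ∏ s, (if B s ≠ B (ξ s) then p else q) = ∏ r, w (E B r) := by
    intro B
    rw [← Equiv.prod_comp e, Fintype.prod_prod_type]
    refine Finset.prod_congr rfl fun r _ => ?_
    simp only [w, hE, he]
  have hw : ∑ φ, w φ = 2 * p ^ 2 + 2 * q ^ 2 := by
    rw [← Equiv.sum_comp (Equiv.boolArrowEquivProd Bool).symm, Fintype.sum_prod_type]
    simp [w, Equiv.boolArrowEquivProd]
    ring
  simp_rw [hprod, h3]
  rw [Equiv.sum_comp E (fun F => ∏ r, w (F r))]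
  have := Finset.prod_univ_sum (fun _ : R => (Finset.univ : Finset (Bool → Bool)))
    (fun _ φ => w φ)
  rw [Fintype.piFinset_univ] at this
  rw [← this, hw, Finset.prod_const, Finset.card_univ, hR]

theorem card_cutCount_lt_le {S : Type*} [Fintype S] [DecidableEq S] {ξ : S → S} (a : ℕ)
    (hS : Fintype.card S = 2 * a) (hξ : ξ ∈ fpfInvolutions S) (y : ℝ) (hy : 0 < y)
    (hy4 : y < 1 / 4) :
    ((Finset.univ.filter (fun B : S → Bool => (cutCount ξ B : ℝ) < 2 * (y * (2 * a)))).card : ℝ)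
      ≤ Real.exp (2 * a * (Real.negMulLog y + Real.negMulLog (1 / 2 - y))) := by
  have hq : 0 < 1 / 2 - y := by linarith
  set p := Real.sqrt y
  set q := Real.sqrt (1 / 2 - y)
  have hp0 : 0 < p := Real.sqrt_pos.2 hy
  have hq0 : 0 < q := Real.sqrt_pos.2 hq
  have hsum := sum_pow_cutCount a hS hξ p q
  rw [Real.sq_sqrt hy.le, Real.sq_sqrt hq.le, show 2 * y + 2 * (1 / 2 - y) = 1 by ring,
    one_pow] at hsum
  have hterm : ∀ B ∈ Finset.univ.filter
      (fun B : S → Bool => (cutCount ξ B : ℝ) < 2 * (y * (2 * a))),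
      Real.exp (-(2 * a * (Real.negMulLog y + Real.negMulLog (1 / 2 - y)))) ≤
        p ^ cutCount ξ B * q ^ (2 * a - cutCount ξ B) := by
    intro B hB
    have hB := (Finset.mem_filter.1 hB).2
    have hc : cutCount ξ B ≤ 2 * a := hS ▸ Finset.card_le_univ _
    rw [← Real.exp_log hp0, ← Real.exp_log hq0, ← Real.exp_nat_mul, ← Real.exp_nat_mul,
      ← Real.exp_add, Real.exp_le_exp, Real.log_sqrt hy.le, Real.log_sqrt hq.le]
    push_cast [Nat.cast_sub hc]
    have hlog : Real.log y ≤ Real.log (1 / 2 - y) := Real.log_le_log hy (by linarith)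
    simp only [Real.negMulLog]
    nlinarith
  have h1 := Finset.card_nsmul_le_sum _ _ _ hterm
  have h2 := Finset.sum_le_univ_sum_of_nonneg
    (s := Finset.univ.filter (fun B : S → Bool => (cutCount ξ B : ℝ) < 2 * (y * (2 * a))))
    (f := fun B => p ^ cutCount ξ B * q ^ (2 * a - cutCount ξ B)) (fun B => by positivity)
  rw [hsum] at h2
  rw [nsmul_eq_mul, Real.exp_neg] at h1
  have h3 := h1.trans h2
  rwa [← div_eq_mul_inv, div_le_one (Real.exp_pos _)] at h3

theorem card_filter_cutCount_le {S : Type*} [Fintype S] [DecidableEq S] (t : ℝ) (B B' : S → Bool)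
    (h : (Finset.univ.filter (fun s => B s = true)).card =
      (Finset.univ.filter (fun s => B' s = true)).card) :
    ((fpfInvolutions S).filter (fun ξ => (cutCount ξ B : ℝ) < t)).card ≤
      ((fpfInvolutions S).filter (fun ξ => (cutCount ξ B' : ℝ) < t)).card := by
  have e0 : {s // B s = true} ≃ {s // B' s = true} :=
    Fintype.equivOfCardEq (by rw [Fintype.card_subtype, Fintype.card_subtype, h])
  let π : Equiv.Perm S := e0.extendSubtype
  have hπ : ∀ s, B' (π s) = B s := by
    intro s
    by_cases hs : B s = true
    · rw [hs]; exact e0.extendSubtype_mem s hs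
    · have := e0.extendSubtype_not_mem s hs
      rw [Bool.not_eq_true] at this hs
      rw [hs]; exact this
  refine Finset.card_le_card_of_injOn (fun ξ s => π (ξ (π.symm s))) ?_ ?_
  · intro ξ hξ
    simp only [Finset.coe_filter, Set.mem_ofPred_eq, fpfInvolutions, Finset.mem_filter,
      Finset.mem_univ, true_and] at hξ ⊢
    refine ⟨⟨by simp [hξ.1.1], fun s hs => hξ.1.2 (π.symm s) ?_⟩, ?_⟩
    · rw [Equiv.eq_symm_apply]; exact hs
    · refine lt_of_eq_of_lt ?_ hξ.2
      congr 1
      refine (Finset.card_bij (fun s _ => π s) ?_ (fun _ _ _ _ hh => π.injective hh) ?_).symm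
      · intro s hs
        simpa [hπ] using hs
      · intro s hs
        refine ⟨π.symm s, ?_, by simp⟩
        rw [Finset.mem_filter] at hs ⊢
        refine ⟨Finset.mem_univ _, ?_⟩
        simpa [← hπ] using hs.2
  · intro ξ _ ξ' _ hh
    funext s
    have := congrFun hh (π s)
    simpa using this

theorem centralBinom_mul_card_filter_cutCount_le {S : Type*} [Fintype S] [DecidableEq S] (a : ℕ)
    (hS : Fintype.card S = 2 * a) (B : S → Bool)
    (hB : (Finset.univ.filter (fun s => B s = true)).card = a)
    (y : ℝ) (hy : 0 < y) (hy4 : y < 1 / 4) :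
    (Nat.centralBinom a : ℝ) *
        ((fpfInvolutions S).filter (fun ξ => (cutCount ξ B : ℝ) < 2 * (y * (2 * a)))).card ≤
      (fpfInvolutions S).card *
        Real.exp (2 * a * (Real.negMulLog y + Real.negMulLog (1 / 2 - y))) := by
  let T : Finset (S → Bool) :=
    Finset.univ.filter (fun B => (Finset.univ.filter (fun s => B s = true)).card = a)
  have hT : Nat.centralBinom a ≤ T.card := by
    rw [Nat.centralBinom, ← hS, ← Finset.card_univ, ← Finset.card_powersetCard]
    refine Finset.card_le_card_of_injOn (fun t s => decide (s ∈ t)) ?_ ?_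
    · intro t ht
      rw [Finset.mem_coe, Finset.mem_powersetCard] at ht
      simp [T, ht]
    · intro t _ t' _ htt
      ext s
      simpa using congrFun htt s
  have h1 : T.card • ((fpfInvolutions S).filter
        (fun ξ => (cutCount ξ B : ℝ) < 2 * (y * (2 * a)))).card ≤
      ∑ B' ∈ T, ((fpfInvolutions S).filter
        (fun ξ => (cutCount ξ B' : ℝ) < 2 * (y * (2 * a)))).card := by
    refine Finset.card_nsmul_le_sum _ _ _ fun B' hB' => card_filter_cutCount_le _ B B' ?_
    rw [hB, (Finset.mem_filter.1 hB').2]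
  have h2 : ∑ B' ∈ T, ((fpfInvolutions S).filter
        (fun ξ => (cutCount ξ B' : ℝ) < 2 * (y * (2 * a)))).card =
      ∑ ξ ∈ fpfInvolutions S, (T.filter
        (fun B' => (cutCount ξ B' : ℝ) < 2 * (y * (2 * a)))).card :=
    (Finset.sum_card_bipartiteAbove_eq_sum_card_bipartiteBelow _)
  have h3 : ((∑ ξ ∈ fpfInvolutions S, (T.filter
        (fun B' => (cutCount ξ B' : ℝ) < 2 * (y * (2 * a)))).card : ℕ) : ℝ) ≤
      (fpfInvolutions S).card •
        Real.exp (2 * a * (Real.negMulLog y + Real.negMulLog (1 / 2 - y))) := by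
    push_cast
    refine Finset.sum_le_card_nsmul _ _ _ fun ξ hξ => ?_
    refine le_trans ?_ (card_cutCount_lt_le a hS hξ y hy hy4)
    exact_mod_cast Finset.card_le_card (Finset.filter_subset_filter _ (Finset.subset_univ _))
  rw [nsmul_eq_mul] at h3
  refine le_trans ?_ h3
  rw [← h2]
  refine le_trans ?_ (Nat.cast_le.2 h1)
  push_cast [smul_eq_mul]
  gcongr

theorem card_filter_cutCount_le_exp {S : Type*} [Fintype S] [DecidableEq S] (a : ℕ) (ha : 0 < a)
    (hS : Fintype.card S = 2 * a) (B : S → Bool)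
    (hB : (Finset.univ.filter (fun s => B s = true)).card = a)
    (y : ℝ) (hy : 0 < y) (hy4 : y < 1 / 4) :
    (((fpfInvolutions S).filter (fun ξ => (cutCount ξ B : ℝ) < 2 * (y * (2 * a)))).card : ℝ) ≤
      (fpfInvolutions S).card * (2 * a *
        Real.exp (2 * a * (Real.negMulLog y + Real.negMulLog (1 / 2 - y) - Real.log 2))) := by
  have h1 := centralBinom_mul_card_filter_cutCount_le a hS B hB y hy hy4
  have h2 : (4 : ℝ) ^ a ≤ 2 * a * Nat.centralBinom a := by
    exact_mod_cast Nat.four_pow_le_two_mul_self_mul_centralBinom a ha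
  have h4 : (4 : ℝ) ^ a = Real.exp (2 * a * Real.log 2) := by
    rw [show (2 : ℝ) * a * Real.log 2 = a * (2 * Real.log 2) by ring, Real.exp_nat_mul, two_mul,
      Real.exp_add, Real.exp_log two_pos]
    norm_num
  rw [mul_sub, Real.exp_sub, ← h4]
  set X := Real.exp (2 * a * (Real.negMulLog y + Real.negMulLog (1 / 2 - y)))
  have h5 : (0 : ℝ) < 4 ^ a := by positivity
  rw [← mul_div_assoc, ← mul_div_assoc, le_div_iff₀ h5]
  have ha' : (0 : ℝ) < a := by exact_mod_cast ha
  calc _ ≤ (((fpfInvolutions S).filter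
          (fun ξ => (cutCount ξ B : ℝ) < 2 * (y * (2 * a)))).card : ℝ) *
          (2 * a * Nat.centralBinom a) := by gcongr
    _ = 2 * a * (Nat.centralBinom a * ((fpfInvolutions S).filter
          (fun ξ => (cutCount ξ B : ℝ) < 2 * (y * (2 * a)))).card) := by ring
    _ ≤ 2 * a * ((fpfInvolutions S).card * X) := by gcongr
    _ = _ := by ring

theorem half_rate_product_eq_exp (δ y : ℝ) (hy : 0 < y) (hy2 : y < 1 / 2) :
    (1 / 2 : ℝ) ^ ((1 / 2 : ℝ) * (1 - 1 / δ)) *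
        (1 - 1 / 2 : ℝ) ^ ((1 - 1 / 2 : ℝ) * (1 - 1 / δ)) *
        (1 - 1 / 2 - y) ^ (-(1 - 1 / 2 - y) / 2) * (1 / 2 - y) ^ (-(1 / 2 - y) / 2) * y ^ (-y) =
      Real.exp (Real.log 2 / δ - Real.log 2 + (Real.negMulLog y + Real.negMulLog (1 / 2 - y))) := by
  have hq : 0 < 1 / 2 - y := by linarith
  have h12 : (0 : ℝ) < 1 / 2 := by norm_num
  have hlog : Real.log (1 / 2) = -Real.log 2 := by
    rw [one_div, Real.log_inv]
  rw [show (1 - 1 / 2 : ℝ) = 1 / 2 by norm_num]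
  rw [Real.rpow_def_of_pos h12, Real.rpow_def_of_pos hq, Real.rpow_def_of_pos hy, ← Real.exp_add,
    ← Real.exp_add, ← Real.exp_add, ← Real.exp_add, hlog]
  congr 1
  simp only [Real.negMulLog]
  ring

theorem half_entropy_quarter :
    Real.negMulLog (1 / 4) + Real.negMulLog (1 / 2 - 1 / 4) = Real.log 2 := by
  have : Real.log (1 / 4) = -(2 * Real.log 2) := by
    rw [one_div, Real.log_inv, show (4 : ℝ) = 2 ^ 2 by norm_num, Real.log_pow]
    norm_num
  rw [show (1 / 2 - 1 / 4 : ℝ) = 1 / 4 by norm_num, Real.negMulLog, this]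
  ring

theorem Idelta_half_le (δ : ℝ) (hδ : 0 < δ) : Idelta δ (1 / 2) ≤ 1 / 4 := by
  refine csInf_le ⟨0, fun y hy => hy.1.le⟩ ⟨by norm_num, by norm_num, ?_⟩
  rw [half_rate_product_eq_exp δ (1 / 4) (by norm_num) (by norm_num), Real.one_lt_exp_iff]
  rw [half_entropy_quarter]
  have : 0 < Real.log 2 / δ := div_pos (Real.log_pos one_lt_two) hδ
  linarith

theorem rate_nonpos_of_lt_Idelta (δ y : ℝ) (hy : 0 < y) (hy2 : y < 1 / 2)
    (hI : y < Idelta δ (1 / 2)) :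
    Real.log 2 / δ - Real.log 2 + (Real.negMulLog y + Real.negMulLog (1 / 2 - y)) ≤ 0 := by
  by_contra! hc
  refine notMem_of_lt_csInf hI ⟨0, fun y hy => hy.1.le⟩ ⟨hy, hy2.le, ?_⟩
  rw [half_rate_product_eq_exp δ y hy hy2, Real.one_lt_exp_iff]
  exact hc

theorem concaveOn_half_entropy :
    ConcaveOn ℝ (Set.Icc 0 (1 / 2))
      (fun y : ℝ => Real.negMulLog y + Real.negMulLog (1 / 2 - y)) := by
  refine ConcaveOn.add ?_ ?_
  · exact Real.concaveOn_negMulLog.subset (fun y hy => hy.1) (convex_Icc _ _)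
  · refine ⟨convex_Icc _ _, fun x hx y hy a b ha hb hab => ?_⟩
    have := Real.concaveOn_negMulLog.2 (x := 1 / 2 - x) (y := 1 / 2 - y)
      (by simpa using hx.2) (by simpa using hy.2) ha hb hab
    convert this using 2
    simp only [smul_eq_mul]
    linear_combination (-1 / 2 : ℝ) * hab

theorem rate_le_of_Idelta_sub (δ η : ℝ) (hδ : 0 < δ) (hη : 0 < η)
    (hy : 0 < Idelta δ (1 / 2) - η) :
    Real.log 2 / δ - Real.log 2 + (Real.negMulLog (Idelta δ (1 / 2) - η) +
      Real.negMulLog (1 / 2 - (Idelta δ (1 / 2) - η))) ≤ -(2 * η * (Real.log 2 / δ)) := by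
  have hI := Idelta_half_le δ hδ
  set I := Idelta δ (1 / 2)
  have hL : 0 < Real.log 2 / δ := div_pos (Real.log_pos one_lt_two) hδ
  have hz := rate_nonpos_of_lt_Idelta δ (I - η / 2) (by linarith) (by linarith) (by linarith)
  have hden : 0 < 1 / 4 - (I - η) := by linarith
  set t := (η / 2) / (1 / 4 - (I - η)) with ht
  have ht0 : 0 < t := by positivity
  have ht1 : t ≤ 1 / 2 := by
    rw [ht, div_le_iff₀ hden]; linarith
  have ht2 : 2 * η ≤ t := by
    rw [ht, le_div_iff₀ hden]; nlinarith
  have hmul : t * (1 / 4 - (I - η)) = η / 2 := div_mul_cancel₀ _ hden.ne'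
  have hconc := concaveOn_half_entropy.2 (x := I - η) (y := 1 / 4)
    ⟨by linarith, by linarith⟩ ⟨by norm_num, by norm_num⟩
    (show 0 ≤ 1 - t by linarith) ht0.le (by ring)
  simp only [smul_eq_mul] at hconc
  rw [show (1 - t) * (I - η) + t * (1 / 4) = I - η / 2 by linear_combination hmul] at hconc
  rw [half_entropy_quarter] at hconc
  set F := Real.negMulLog (I - η) + Real.negMulLog (1 / 2 - (I - η))
  set L := Real.log 2 / δ
  have h5 : (1 - t) * (L - Real.log 2 + F) ≤ -(t * L) := by nlinarith
  have h6 : t * L ≥ 2 * η * L := by gcongr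
  have h7 : L - Real.log 2 + F ≤ 0 := by
    by_contra! hc
    have : 0 < (1 - t) * (L - Real.log 2 + F) := mul_pos (by linarith) hc
    have : 0 < t * L := by positivity
    linarith
  nlinarith

theorem eventually_sqrt_pow_mul_exp_le (c ε : ℝ) (hc : 0 < c) (hε : 0 < ε) :
    ∀ᶠ n : ℕ in Filter.atTop,
      Real.sqrt n ^ 3 * Real.exp (-(c * Real.sqrt n)) ≤ ε := by
  have h1 : Filter.Tendsto (fun n : ℕ => c * Real.sqrt n) Filter.atTop Filter.atTop :=
    (Real.tendsto_sqrt_atTop.comp tendsto_natCast_atTop_atTop).const_mul_atTop hc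
  have h2 := (Real.tendsto_pow_mul_exp_neg_atTop_nhds_zero 3).comp h1
  filter_upwards [h2.eventually (gt_mem_nhds (show (0 : ℝ) < c ^ 3 * ε by positivity))] with n hn
  simp only [Function.comp_apply, mul_pow, mul_assoc] at hn
  exact (lt_of_mul_lt_mul_left hn (by positivity)).le

theorem eventually_sqrt_le_mul (c : ℝ) (hc : 0 < c) :
    ∀ᶠ n : ℕ in Filter.atTop, Real.sqrt n ≤ c * n := by
  have h1 : Filter.Tendsto (fun n : ℕ => Real.sqrt n) Filter.atTop Filter.atTop :=
    Real.tendsto_sqrt_atTop.comp tendsto_natCast_atTop_atTop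
  filter_upwards [h1.eventually_ge_atTop (1 / c)] with n hn
  rw [div_le_iff₀ hc] at hn
  have := Real.mul_self_sqrt (Nat.cast_nonneg (α := ℝ) n)
  nlinarith [Real.sqrt_nonneg (n : ℝ)]

theorem exists_extension_cutCount_le {S : Type*} [Fintype S] [DecidableEq S] (a : ℕ)
    (ha : a ≤ Fintype.card S) (B₀ : S → Bool)
    (h₀ : (Finset.univ.filter (fun s => B₀ s = true)).card ≤ a) :
    ∃ B : S → Bool, (Finset.univ.filter (fun s => B s = true)).card = a ∧
      ∀ ξ ∈ fpfInvolutions S, cutCount ξ B ≤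
        cutCount ξ B₀ + 2 * (a - (Finset.univ.filter (fun s => B₀ s = true)).card) := by
  obtain ⟨T, hT, hTa⟩ := Finset.exists_superset_card_eq h₀ ha
  refine ⟨fun s => decide (s ∈ T), by simpa using hTa, fun ξ hξ => ?_⟩
  have hξ := (Finset.mem_filter.1 hξ).2.1
  set T₀ := Finset.univ.filter (fun s => B₀ s = true) with hT₀
  have hsdiff : (T \ T₀).card = a - T₀.card := by rw [Finset.card_sdiff_of_subset hT, hTa]
  have himg : ((T \ T₀).image ξ).card ≤ a - T₀.card := hsdiff ▸ Finset.card_image_le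
  have hmem : ∀ s, s ∉ T \ T₀ → decide (s ∈ T) = B₀ s := by
    intro s hs
    rw [Finset.mem_sdiff, not_and_not_right] at hs
    by_cases h : B₀ s = true
    · have : s ∈ T := hT (by simp [hT₀, h])
      simp [h, this]
    · have : s ∉ T := fun hc => h (by simpa [hT₀] using hs hc)
      simp [Bool.eq_false_of_not_eq_true h, this]
  have hsub : Finset.univ.filter (fun s => decide (s ∈ T) ≠ decide (ξ s ∈ T)) ⊆
      Finset.univ.filter (fun s => B₀ s ≠ B₀ (ξ s)) ∪ ((T \ T₀) ∪ (T \ T₀).image ξ) := by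
    intro s hs
    by_contra hc
    simp only [Finset.mem_union, not_or] at hc
    have h2 : ξ s ∉ T \ T₀ := fun h => hc.2.2 (Finset.mem_image.2 ⟨ξ s, h, hξ s⟩)
    have h3 := (Finset.mem_filter.1 hs).2
    rw [hmem s hc.2.1, hmem _ h2] at h3
    exact hc.1 (by simpa using h3)
  have h1 := Finset.card_le_card hsub
  have h2 := Finset.card_union_le (Finset.univ.filter (fun s => B₀ s ≠ B₀ (ξ s)))
    ((T \ T₀) ∪ (T \ T₀).image ξ)
  have h3 := Finset.card_union_le (T \ T₀) ((T \ T₀).image ξ)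
  refine h1.trans (h2.trans ?_)
  unfold cutCount
  omega

/-- The total degree of the vertices carrying a plus spin. -/
def plusDegree {n : ℕ} (d : Fin n → ℕ) (σ : Fin n → Bool) : ℕ :=
  ∑ i, if σ i then d i else 0

theorem ellPart_self (n : ℕ) (d : Fin n → ℕ) : ellPart n d n = ∑ i, d i := by
  simp [ellPart]

theorem card_plus_stubs {n : ℕ} (d : Fin n → ℕ) (σ : Fin n → Bool) :
    (Finset.univ.filter (fun s : Σ i : Fin n, Fin (d i) => σ s.1 = true)).card =
      plusDegree d σ := by
  rw [Finset.card_filter, Fintype.sum_sigma, plusDegree]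
  refine Finset.sum_congr rfl fun i _ => ?_
  cases h : σ i <;> simp [h]

theorem plusDegree_flip_le {n : ℕ} (d : Fin n → ℕ) (σ : Fin n → Bool) (v : Fin n) :
    plusDegree d (Function.update σ v (! σ v)) ≤ plusDegree d σ + d v := by
  have : d v = ∑ i, if i = v then d i else 0 := by simp
  rw [this, plusDegree, plusDegree, ← Finset.sum_add_distrib]
  refine Finset.sum_le_sum fun i _ => ?_
  by_cases h : i = v
  · subst h; simp; split <;> omega
  · simp [h]

theorem card_plus_le_of_plusDegree_le {n : ℕ} {d : Fin n → ℕ} (hd : ∀ i, 0 < d i)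
    (hmono : Monotone d) (m : ℕ) (σ : Fin n → Bool) (h : plusDegree d σ ≤ ellPart n d m) :
    (Finset.univ.filter (fun i => σ i = true)).card ≤ m := by
  by_contra! hc
  have hmn : m < n := by
    have := Finset.card_le_univ (Finset.univ.filter (fun i => σ i = true))
    rw [Fintype.card_fin] at this
    omega
  have hD := hd ⟨m, hmn⟩
  set D := d ⟨m, hmn⟩
  have hm : ∑ i : Fin n, (if (i : ℕ) < m then 1 else 0) = m := by
    rw [← Finset.card_filter, Fin.card_filter_val_lt, min_eq_right hmn.le]
  have key : ∑ i : Fin n, ((if (i : ℕ) < m then d i else 0) + D * (if σ i then 1 else 0)) ≤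
      ∑ i : Fin n, ((if σ i then d i else 0) + D * (if (i : ℕ) < m then 1 else 0)) := by
    refine Finset.sum_le_sum fun i _ => ?_
    by_cases h1 : (i : ℕ) < m
    · have : d i ≤ D := hmono (Fin.le_def.2 h1.le)
      split_ifs <;> simp [this]
    · have : D ≤ d i := hmono (Fin.le_def.2 (not_lt.1 h1))
      split_ifs <;> simp [this]
  rw [Finset.sum_add_distrib, Finset.sum_add_distrib, ← Finset.mul_sum, ← Finset.mul_sum, hm,
    ← Finset.card_filter] at key
  change ellPart n d m + _ ≤ plusDegree d σ + _ at key
  have := Nat.mul_lt_mul_of_pos_left hc hD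
  omega

theorem cmHamiltonian_eq (n : ℕ) (d : Fin n → ℕ) (J h : ℝ)
    (ξ : (Σ i : Fin n, Fin (d i)) → (Σ i : Fin n, Fin (d i))) (σ : Fin n → Bool) :
    cmHamiltonian n d J h ξ σ =
      J / 2 * cutCount ξ (fun s => σ s.1) -
        h * (Finset.univ.filter (fun i => σ i = true)).card +
        (h / 2 * n - J / 4 * Fintype.card (Σ i : Fin n, Fin (d i))) := by
  have h1 : ∀ b b' : Bool, spin b * spin b' = 1 - 2 * (if b ≠ b' then 1 else 0) := by
    intro b b'
    cases b <;> cases b' <;> norm_num [spin]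
  have h2 : ∀ b : Bool, spin b = 2 * (if b = true then 1 else 0) - 1 := by
    intro b
    cases b <;> norm_num [spin]
  have h3 : ∑ i, spin (σ i) = 2 * (Finset.univ.filter (fun i => σ i = true)).card - n := by
    simp_rw [h2]
    rw [Finset.sum_sub_distrib, ← Finset.mul_sum, Finset.sum_boole]
    simp
  have h4 : ∑ s : Σ i : Fin n, Fin (d i), spin (σ s.1) * spin (σ (ξ s).1) =
      Fintype.card (Σ i : Fin n, Fin (d i)) - 2 * cutCount ξ (fun s => σ s.1) := by
    simp_rw [h1]
    rw [Finset.sum_sub_distrib, ← Finset.mul_sum, Finset.sum_boole, cutCount, Finset.sum_const,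
      Finset.card_univ, nsmul_eq_mul, mul_one]
  rw [cmHamiltonian, h3, h4]
  ring

theorem cmHamiltonian_sub_minus (n : ℕ) (d : Fin n → ℕ) (J h : ℝ)
    (ξ : (Σ i : Fin n, Fin (d i)) → (Σ i : Fin n, Fin (d i))) (σ : Fin n → Bool) :
    cmHamiltonian n d J h ξ σ - cmHamiltonian n d J h ξ (fun _ => false) =
      J / 2 * cutCount ξ (fun s => σ s.1) -
        h * (Finset.univ.filter (fun i => σ i = true)).card := by
  rw [cmHamiltonian_eq, cmHamiltonian_eq]
  simp [cutCount]

theorem exists_flip_path (n : ℕ) : ∃ γ : Fin (n + 1) → (Fin n → Bool),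
    γ 0 = (fun _ => false) ∧ γ (Fin.last n) = (fun _ => true) ∧
      ∀ i : Fin n, IsFlipStep (γ i.castSucc) (γ i.succ) := by
  refine ⟨fun i v => decide ((v : ℕ) < (i : ℕ)), by simp, by simp, fun i => ⟨i, ?_⟩⟩
  funext v
  by_cases h : v = i
  · subst h; simp
  · have : (v : ℕ) ≠ i := fun hc => h (Fin.ext hc)
    rw [Function.update_of_ne h]
    simp only [Fin.val_succ, Fin.val_castSucc, decide_eq_decide]
    omega

/-- Every single-flip path from all-minus to all-plus contains a configuration that is one flip
away from exceeding half of the total degree, so lower bounds for the energy of such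
configurations are lower bounds for the barrier. -/
theorem le_gammaStar {n : ℕ} (d : Fin n → ℕ) (hpos : 0 < ∑ i, d i) (H : (Fin n → Bool) → ℝ)
    (t : ℝ)
    (ht : ∀ σ v, 2 * plusDegree d σ ≤ ∑ i, d i → ∑ i, d i < 2 * (plusDegree d σ + d v) →
      t ≤ H σ - H (fun _ => false)) :
    t ≤ gammaStar H := by
  rw [gammaStar, commHeight, le_sub_iff_add_le]
  refine le_csInf ?_ ?_
  · obtain ⟨γ, h0, h1, h2⟩ := exists_flip_path n
    exact ⟨_, n, γ, h0, h1, h2, rfl⟩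
  · rintro M ⟨k, γ, h0, h1, h2, rfl⟩
    obtain ⟨i, hi, hi'⟩ : ∃ i : Fin k, 2 * plusDegree d (γ i.castSucc) ≤ ∑ i, d i ∧
        ∑ i, d i < 2 * plusDegree d (γ i.succ) := by
      by_contra! hc
      have hall : ∀ i : Fin (k + 1), 2 * plusDegree d (γ i) ≤ ∑ i, d i := by
        intro i
        induction i using Fin.induction with
        | zero => simp [h0, plusDegree]
        | succ i ih => exact hc i ih
      have := hall (Fin.last k)
      rw [h1] at this
      simp only [plusDegree, if_true] at this
      omega
    obtain ⟨v, hv⟩ := h2 i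
    rw [hv] at hi'
    have h3 := ht (γ i.castSucc) v hi
      (hi'.trans_le (Nat.mul_le_mul_left 2 (plusDegree_flip_le d _ v)))
    have h4 := Finset.le_sup' (fun i => H (γ i)) (Finset.mem_univ i.castSucc)
    exact (le_sub_iff_add_le.1 h3).trans h4

theorem cmMatchings_eq (n : ℕ) (d : Fin n → ℕ) :
    cmMatchings n d = fpfInvolutions (Σ i : Fin n, Fin (d i)) := by
  ext ξ
  simp [cmMatchings, fpfInvolutions]

/-- If the barrier of a matching falls short of `J·I·ℓ − h·m − 2Jε'·n`, then some spin
configuration gives rise to a bipartition of the stubs into halves with fewer than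
`I·ℓ − ε'·n` cut pairs. -/
theorem exists_cutCount_lt_of_gammaStar_lt {n a m : ℕ} {d : Fin n → ℕ} {J h ε' I : ℝ}
    (hJ : 0 < J) (hh : 0 < h) (ha : 0 < a) (hd : ∀ i, 0 < d i)
    (hdn : ∀ i, (d i : ℝ) ≤ ε' * n) (hmono : Monotone d) (hsum : ∑ i, d i = 2 * a)
    (hm : a ≤ ellPart n d m)
    (B : (Fin n → Bool) → (Σ i : Fin n, Fin (d i)) → Bool)
    (hB : ∀ σ, plusDegree d σ ≤ a → ∀ ξ ∈ cmMatchings n d,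
      cutCount ξ (B σ) ≤ cutCount ξ (fun s => σ s.1) + 2 * (a - plusDegree d σ))
    {ξ : (Σ i : Fin n, Fin (d i)) → (Σ i : Fin n, Fin (d i))} (hξ : ξ ∈ cmMatchings n d)
    (hbad : gammaStar (cmHamiltonian n d J h ξ) <
      J * I * (2 * a : ℕ) - h * m - 2 * J * ε' * n) :
    ∃ σ, (cutCount ξ (B σ) : ℝ) < 2 * (I * (2 * a) - ε' * n) := by
  by_contra! hc
  refine hbad.not_ge (le_gammaStar d (by omega) _ _ fun σ v h1 h2 => ?_)
  rw [cmHamiltonian_sub_minus]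
  have hσ : plusDegree d σ ≤ a := by omega
  have h3 := hB σ hσ ξ hξ
  have h4 : ((Finset.univ.filter (fun i => σ i = true)).card : ℝ) ≤ m := by
    exact_mod_cast card_plus_le_of_plusDegree_le hd hmono m σ (hσ.trans hm)
  have h5 : cutCount ξ (B σ) ≤ cutCount ξ (fun s => σ s.1) + 2 * d v := by omega
  have h6 : (cutCount ξ (B σ) : ℝ) ≤ cutCount ξ (fun s => σ s.1) + 2 * d v := by
    exact_mod_cast h5
  have h7 := hc σ
  have h8 := hdn v
  have h9 : 2 * (I * (2 * a)) - 4 * (ε' * n) ≤ (cutCount ξ (fun s => σ s.1) : ℝ) := by linarith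
  have h10 := mul_le_mul_of_nonneg_left h9 (half_pos hJ).le
  have h11 := mul_le_mul_of_nonneg_left h4 hh.le
  push_cast
  linarith

/-- Union bound over all spin configurations. -/
theorem card_filter_exists_cutCount_lt_le {n a : ℕ} {d : Fin n → ℕ} {ε' : ℝ} (hn : 0 < n)
    (ha : 0 < a) (hε : 0 < ε') (hsum : ∑ i, d i = 2 * a)
    (hdn : ∀ i, (d i : ℝ) ≤ Real.sqrt n)
    (B : (Fin n → Bool) → (Σ i : Fin n, Fin (d i)) → Bool)
    (hB : ∀ σ, (Finset.univ.filter (fun s => B σ s = true)).card = a)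
    (hI : 0 < Idelta ((2 * a : ℕ) / (n : ℝ)) (1 / 2) * (2 * a) - ε' * n) :
    (((cmMatchings n d).filter (fun ξ => ∃ σ, (cutCount ξ (B σ) : ℝ) <
        2 * (Idelta ((2 * a : ℕ) / (n : ℝ)) (1 / 2) * (2 * a) - ε' * n))).card : ℝ) ≤
      (cmMatchings n d).card * (Real.sqrt n ^ 3 *
        Real.exp (-(2 * ε' * Real.log 2 * Real.sqrt n))) := by
  classical
  have hn' : (0 : ℝ) < n := by exact_mod_cast hn
  have ha' : (0 : ℝ) < a := by exact_mod_cast ha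
  have hsn : 0 < Real.sqrt n := Real.sqrt_pos.2 hn'
  have hsq : Real.sqrt n * Real.sqrt n = n := Real.mul_self_sqrt hn'.le
  rw [cmMatchings_eq]
  push_cast at hI ⊢
  set δ : ℝ := 2 * a / n with hδ
  have hδ0 : 0 < δ := by positivity
  have hδn : δ * n = 2 * a := div_mul_cancel₀ _ hn'.ne'
  have hℓ : (2 * a : ℝ) ≤ n * Real.sqrt n := by
    have h1 : ((∑ i, d i : ℕ) : ℝ) ≤ ∑ _i : Fin n, Real.sqrt n := by
      push_cast
      exact Finset.sum_le_sum fun i _ => hdn i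
    rw [hsum] at h1
    simpa using h1
  have hδs : δ ≤ Real.sqrt n := by
    rw [hδ, div_le_iff₀ hn']; linarith
  set η : ℝ := ε' / δ with hη
  have hη0 : 0 < η := by positivity
  have hηδ : η * δ = ε' := div_mul_cancel₀ _ hδ0.ne'
  set I := Idelta δ (1 / 2) with hIdef
  have hy_eq : I * (2 * a) - ε' * n = (I - η) * (2 * a) := by
    rw [← hδn, ← hηδ]; ring
  rw [hy_eq] at hI ⊢
  have hy : 0 < I - η := pos_of_mul_pos_left hI (by positivity)
  have hI4 : I ≤ 1 / 4 := Idelta_half_le δ hδ0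
  have hrate := rate_le_of_Idelta_sub δ η hδ0 hη0 hy
  rw [← hIdef] at hrate
  have hcard : Fintype.card (Σ i : Fin n, Fin (d i)) = 2 * a := by simp [hsum]
  set F := Real.negMulLog (I - η) + Real.negMulLog (1 / 2 - (I - η)) with hF
  set M := fpfInvolutions (Σ i : Fin n, Fin (d i)) with hM
  have hsub : M.filter (fun ξ => ∃ σ, (cutCount ξ (B σ) : ℝ) < 2 * ((I - η) * (2 * a))) ⊆
      Finset.univ.biUnion (fun σ => M.filter
        (fun ξ => (cutCount ξ (B σ) : ℝ) < 2 * ((I - η) * (2 * a)))) := by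
    intro ξ hξ
    obtain ⟨h1, σ, h2⟩ := Finset.mem_filter.1 hξ
    exact Finset.mem_biUnion.2 ⟨σ, Finset.mem_univ _, Finset.mem_filter.2 ⟨h1, h2⟩⟩
  have h1 : ((M.filter
        (fun ξ => ∃ σ, (cutCount ξ (B σ) : ℝ) < 2 * ((I - η) * (2 * a)))).card : ℝ) ≤
      ∑ σ : Fin n → Bool, ((M.filter
        (fun ξ => (cutCount ξ (B σ) : ℝ) < 2 * ((I - η) * (2 * a)))).card : ℝ) := by
    exact_mod_cast (Finset.card_le_card hsub).trans Finset.card_biUnion_le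
  have h2 := Finset.sum_le_card_nsmul Finset.univ
    (fun σ : Fin n → Bool => ((M.filter
        (fun ξ => (cutCount ξ (B σ) : ℝ) < 2 * ((I - η) * (2 * a)))).card : ℝ)) _
    (fun σ _ => card_filter_cutCount_le_exp a ha hcard (B σ) (hB σ) (I - η) hy (by linarith))
  refine (h1.trans h2).trans ?_
  rw [Finset.card_univ, nsmul_eq_mul, Fintype.card_fun, Fintype.card_fin, Fintype.card_bool,
    ← hF, ← hM]
  have h3 : ((2 ^ n : ℕ) : ℝ) = Real.exp (n * Real.log 2) := by
    rw [Real.exp_nat_mul, Real.exp_log two_pos]; norm_num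
  rw [h3]
  have h4 : n * Real.log 2 + 2 * a * (F - Real.log 2) ≤
      -(2 * ε' * Real.log 2 * Real.sqrt n) := by
    have e1 : n * Real.log 2 = 2 * a * (Real.log 2 / δ) := by
      rw [← hδn]; field_simp
    have e2 : n * Real.log 2 + 2 * a * (F - Real.log 2) =
        2 * a * (Real.log 2 / δ - Real.log 2 + F) := by rw [e1]; ring
    have e3 : 2 * a * -(2 * η * (Real.log 2 / δ)) = -(2 * ε' * Real.log 2 * (n / δ)) := by
      rw [← hδn, ← hηδ]; field_simp
    have e4 : Real.sqrt n ≤ n / δ := by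
      rw [le_div_iff₀ hδ0]; nlinarith
    have e5 : 0 < Real.log 2 := Real.log_pos one_lt_two
    rw [e2]
    refine (mul_le_mul_of_nonneg_left hrate (by positivity)).trans ?_
    rw [e3, neg_le_neg_iff]
    gcongr
  calc Real.exp (n * Real.log 2) * (M.card * (2 * a * Real.exp (2 * a * (F - Real.log 2))))
      = M.card * (2 * a * Real.exp (n * Real.log 2 + 2 * a * (F - Real.log 2))) := by
        rw [Real.exp_add]; ring
    _ ≤ M.card * (Real.sqrt n ^ 3 * Real.exp (-(2 * ε' * Real.log 2 * Real.sqrt n))) := by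
        gcongr
        calc (2 * a : ℝ) ≤ n * Real.sqrt n := hℓ
          _ = Real.sqrt n ^ 3 := by rw [pow_succ, sq, hsq]

open Classical in
/-- Fix `J > 0` and `h > 0`. For every `ε > 0` there exists `N` such that for
all `n ≥ N` and every non-decreasing degree sequence `d_1 ≤ ⋯ ≤ d_n` with
`3 ≤ d_i ≤ √n` for all `i` and `ℓ_n` even, writing `ℓ_m = d_1 + ⋯ + d_m`,
`m̃ = min{1 ≤ m ≤ n : ℓ_m ≥ ℓ_n/2}` and `d̄ = ℓ_n/n`, the energy barrier of the
Configuration Model satisfies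
`P[Γ*_n ≥ J·I_{d̄}(1/2)·ℓ_n − h·m̃ − ε·n] ≥ 1 − ε`. -/
theorem stmt13 (J h : ℝ) (hJ : 0 < J) (hh : 0 < h) :
    ∀ ε : ℝ, 0 < ε → ∃ N : ℕ, ∀ n, N ≤ n → ∀ (d : Fin n → ℕ) (mt : ℕ),
      (∀ i, 3 ≤ d i) → (∀ i, (d i : ℝ) ≤ Real.sqrt n) → Monotone d →
      Even (ellPart n d n) →
      (1 ≤ mt ∧ mt ≤ n ∧ ellPart n d n ≤ 2 * ellPart n d mt) →
      (∀ m, 1 ≤ m → m ≤ n → ellPart n d n ≤ 2 * ellPart n d m → mt ≤ m) →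
      1 - ε ≤
        (((cmMatchings n d).filter (fun ξ =>
            J * Idelta ((ellPart n d n : ℝ) / (n : ℝ)) (1/2) * (ellPart n d n : ℝ)
                - h * mt - ε * n
              ≤ gammaStar (cmHamiltonian n d J h ξ))).card : ℝ)
          / ((cmMatchings n d).card : ℝ) := by
  intro ε hε
  set ε' : ℝ := ε / (2 * J) with hε'
  have hε'0 : 0 < ε' := by positivity
  have hε'J : 2 * J * ε' = ε := mul_div_cancel₀ _ (by positivity)
  have hc : 0 < 2 * ε' * Real.log 2 := by
    have := Real.log_pos one_lt_two
    positivity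
  obtain ⟨N, hN⟩ := Filter.eventually_atTop.1
    ((eventually_sqrt_pow_mul_exp_le _ ε hc hε).and (eventually_sqrt_le_mul ε' hε'0))
  refine ⟨max N 1, fun n hn d mt hd3 hdn hmono heven hmt _ => ?_⟩
  have hn1 : 0 < n := (le_max_right N 1).trans hn
  obtain ⟨hN1, hN2⟩ := hN n ((le_max_left N 1).trans hn)
  rw [ellPart_self] at heven hmt ⊢
  obtain ⟨a, hsum⟩ := heven
  rw [← two_mul] at hsum
  rw [hsum] at hmt ⊢
  have ha : 0 < a := by
    have h1 := Finset.single_le_sum (f := d) (fun i _ => Nat.zero_le _)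
      (Finset.mem_univ (⟨0, hn1⟩ : Fin n))
    have h2 := hd3 ⟨0, hn1⟩
    omega
  have hcard : Fintype.card (Σ i : Fin n, Fin (d i)) = 2 * a := by simp [hsum]
  have hex : ∀ σ : Fin n → Bool, ∃ B : (Σ i : Fin n, Fin (d i)) → Bool,
      (Finset.univ.filter (fun s => B s = true)).card = a ∧
      (plusDegree d σ ≤ a → ∀ ξ ∈ cmMatchings n d,
        cutCount ξ B ≤ cutCount ξ (fun s => σ s.1) + 2 * (a - plusDegree d σ)) := by
    intro σ
    by_cases hσ : plusDegree d σ ≤ a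
    · obtain ⟨B, hB, hB'⟩ := exists_extension_cutCount_le a (by omega)
        (fun s : Σ i : Fin n, Fin (d i) => σ s.1) (by rw [card_plus_stubs]; exact hσ)
      rw [card_plus_stubs] at hB'
      exact ⟨B, hB, fun _ => by rw [cmMatchings_eq]; exact hB'⟩
    · obtain ⟨B, hB, -⟩ := exists_extension_cutCount_le a (by omega)
        (fun _ : Σ i : Fin n, Fin (d i) => false) (by simp)
      exact ⟨B, hB, fun h => absurd h hσ⟩
  choose B hBa hBcut using hex
  have hMpos : (0 : ℝ) < (cmMatchings n d).card := by
    rw [cmMatchings_eq]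
    exact_mod_cast (fpfInvolutions_nonempty a hcard).card_pos
  set I := Idelta ((2 * a : ℕ) / (n : ℝ)) (1 / 2) with hI
  have hbad : (((cmMatchings n d).filter (fun ξ => ¬ (J * I * (2 * a : ℕ) - h * mt - ε * n ≤
      gammaStar (cmHamiltonian n d J h ξ)))).card : ℝ) ≤ ε * (cmMatchings n d).card := by
    have hsub : (cmMatchings n d).filter (fun ξ => ¬ (J * I * (2 * a : ℕ) - h * mt - ε * n ≤
        gammaStar (cmHamiltonian n d J h ξ))) ⊆ (cmMatchings n d).filter
          (fun ξ => ∃ σ, (cutCount ξ (B σ) : ℝ) < 2 * (I * (2 * a) - ε' * n)) := by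
      intro ξ hξ
      obtain ⟨h1, h2⟩ := Finset.mem_filter.1 hξ
      rw [not_le, ← hε'J] at h2
      exact Finset.mem_filter.2 ⟨h1, exists_cutCount_lt_of_gammaStar_lt hJ hh ha
        (fun i => three_pos.trans_le (hd3 i)) (fun i => (hdn i).trans hN2) hmono hsum
        (by omega) B hBcut h1 h2⟩
    refine (Nat.cast_le.2 (Finset.card_le_card hsub)).trans ?_
    by_cases hpos : 0 < I * (2 * a) - ε' * n
    · have h1 := card_filter_exists_cutCount_lt_le hn1 ha hε'0 hsum hdn B hBa hpos
      calc _ ≤ _ := by convert h1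
        _ ≤ (cmMatchings n d).card * ε := by gcongr
        _ = _ := mul_comm _ _
    · rw [Finset.filter_false_of_mem]
      · simp only [Finset.card_empty, Nat.cast_zero]
        positivity
      · rintro ξ - ⟨σ, hσ⟩
        have : (0 : ℝ) ≤ cutCount ξ (B σ) := Nat.cast_nonneg _
        linarith
  have hsplit := Finset.card_filter_add_card_filter_not (s := cmMatchings n d)
    (fun ξ => J * I * (2 * a : ℕ) - h * mt - ε * n ≤ gammaStar (cmHamiltonian n d J h ξ))
  have hsplit' := congrArg (Nat.cast (R := ℝ)) hsplit
  push_cast at hsplit' hbad ⊢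
  rw [le_div_iff₀ hMpos]
  linarith
end

section
/- Fix an integer r ≥ 3, J > 0 and 0 < h < J·r. For every ε > 0, as n → ∞ along integers for which r·n is even, the energy barrier of the Configuration Model with constant degree sequence d_i = r for all i satisfies P[ J·r·I_r(1/2)·n − (h/2)·n − ε·n ≤ Γ*_n ≤ (J·r/4)·(1 − (h/(J·r))²)·n + ε·n ] → 1. -/
/-- The number of pairs of the involution `ξ` with exactly one element in `T`. -/
def stubCut {α : Type*} [DecidableEq α] (ξ : α → α) (T : Finset α) : ℕ :=
  (T.filter fun x => ξ x ∉ T).card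

theorem exists_transversal {α : Type*} [Fintype α] [DecidableEq α] (ξ : α → α)
    (hinv : ∀ x, ξ (ξ x) = x) (hfix : ∀ x, ξ x ≠ x) :
    ∃ R : Finset α, (∀ x, x ∈ R ↔ ξ x ∉ R) ∧ 2 * R.card = Fintype.card α := by
  let e := Fintype.equivFin α
  have hR : ∀ x, x ∈ Finset.univ.filter (fun x => e x < e (ξ x)) ↔
      ξ x ∉ Finset.univ.filter (fun x => e x < e (ξ x)) := by
    intro x
    have hne : e x ≠ e (ξ x) := fun hx => hfix x (e.injective hx).symm
    simp only [Finset.mem_filter, Finset.mem_univ, true_and, hinv, not_lt]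
    exact ⟨le_of_lt, fun hle => lt_of_le_of_ne hle hne⟩
  generalize Finset.univ.filter (fun x => e x < e (ξ x)) = R at hR
  refine ⟨R, hR, ?_⟩
  have hc : R.card = Rᶜ.card := by
    refine Finset.card_nbij' ξ ξ ?_ ?_ (fun x _ => hinv x) (fun x _ => hinv x)
    · intro x hx
      simpa using (hR x).1 (by simpa using hx)
    · intro x hx
      have hx' : x ∉ R := by simpa using hx
      have := hR (ξ x)
      rw [hinv] at this
      simpa using this.2 hx'
  have := Finset.card_add_card_compl R
  omega

theorem card_transversal_filter_le_stubCut {α : Type*} [DecidableEq α] (ξ : α → α)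
    (hinv : ∀ x, ξ (ξ x) = x) (R : Finset α) (hR : ∀ x, x ∈ R ↔ ξ x ∉ R) (T : Finset α) :
    (R.filter fun x => decide (x ∈ T) ≠ decide (ξ x ∈ T)).card ≤ stubCut ξ T := by
  refine Finset.card_le_card_of_injOn (fun x => if x ∈ T then x else ξ x) ?_ ?_
  · intro x hx
    have hne := (Finset.mem_filter.1 hx).2
    by_cases hxT : x ∈ T
    · have hξ : ξ x ∉ T := fun hξ => by simp [hxT, hξ] at hne
      simp [hxT, hξ]
    · have hξ : ξ x ∈ T := by
        by_contra hξ
        simp [hxT, hξ] at hne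
      simp [hxT, hξ, hinv]
  · intro x hx y hy hxy
    have hx' := (hR x).1 (Finset.mem_filter.1 hx).1
    have hy' := (hR y).1 (Finset.mem_filter.1 hy).1
    have hxR := (Finset.mem_filter.1 hx).1
    have hyR := (Finset.mem_filter.1 hy).1
    by_cases hxT : x ∈ T <;> by_cases hyT : y ∈ T <;> simp only [hxT, hyT, if_true, if_false] at hxy
    · exact hxy
    · subst hxy; exact absurd hxR hy'
    · subst hxy; exact absurd hyR hx'
    · rw [← hinv x, hxy, hinv]

theorem sum_pow_stubCut_le {α : Type*} [Fintype α] [DecidableEq α] (ξ : α → α)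
    (hinv : ∀ x, ξ (ξ x) = x) (hfix : ∀ x, ξ x ≠ x) {q : ℝ} (hq0 : 0 ≤ q) (hq1 : q ≤ 1)
    {m : ℕ} (hm : Fintype.card α = 2 * m) :
    ∑ T : Finset α, q ^ stubCut ξ T ≤ (2 + 2 * q) ^ m := by
  obtain ⟨R, hR, hcard⟩ := exists_transversal ξ hinv hfix
  have hRm : R.card = m := by omega
  let w : Bool × Bool → ℝ := fun p => if p.1 ≠ p.2 then q else 1
  have hw : ∀ p, 0 ≤ w p := fun p => by
    simp only [w]; split_ifs <;> linarith
  let g : Finset α → R → Bool × Bool := fun T x => (decide (x.1 ∈ T), decide (ξ x.1 ∈ T))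
  have hg : Function.Injective g := by
    intro T T' hTT
    ext x
    by_cases hx : x ∈ R
    · have := congrFun hTT ⟨x, hx⟩
      simp only [g, Prod.mk.injEq, decide_eq_decide] at this
      exact this.1
    · have hx' : ξ x ∈ R := by
        by_contra hx'
        exact hx ((hR x).2 hx')
      have := congrFun hTT ⟨ξ x, hx'⟩
      simp only [g, Prod.mk.injEq, decide_eq_decide, hinv] at this
      exact this.2
  have hterm : ∀ T : Finset α, q ^ stubCut ξ T ≤ ∏ x : R, w (g T x) := by
    intro T
    have hprod : ∏ x : R, w (g T x) =
        q ^ (R.filter fun x => decide (x ∈ T) ≠ decide (ξ x ∈ T)).card := by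
      rw [← Finset.prod_const, Finset.prod_filter, ← Finset.prod_coe_sort R]
    rw [hprod]
    exact pow_le_pow_of_le_one hq0 hq1 (card_transversal_filter_le_stubCut ξ hinv R hR T)
  calc ∑ T : Finset α, q ^ stubCut ξ T ≤ ∑ T : Finset α, ∏ x : R, w (g T x) :=
        Finset.sum_le_sum fun T _ => hterm T
    _ = ∑ f ∈ Finset.univ.image g, ∏ x : R, w (f x) := by
        rw [Finset.sum_image (fun _ _ _ _ h => hg h)]
    _ ≤ ∑ f : R → Bool × Bool, ∏ x : R, w (f x) :=
        Finset.sum_le_sum_of_subset_of_nonneg (Finset.subset_univ _)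
          fun f _ _ => Finset.prod_nonneg fun x _ => hw _
    _ = ∏ _x : R, ∑ p : Bool × Bool, w p := (Fintype.prod_sum fun _ p => w p).symm
    _ = (2 + 2 * q) ^ m := by
        rw [Finset.prod_const, Finset.card_univ, Fintype.card_coe, hRm]
        congr 1
        simp [Fintype.sum_prod_type, w]
        ring

/-- The fixed-point-free involutions of a finite type. -/
def perfectMatchings (α : Type*) [Fintype α] [DecidableEq α] : Finset (α → α) :=
  Finset.univ.filter fun ξ => (∀ s, ξ (ξ s) = s) ∧ ∀ s, ξ s ≠ s

theorem mem_perfectMatchings {α : Type*} [Fintype α] [DecidableEq α] {ξ : α → α} :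
    ξ ∈ perfectMatchings α ↔ (∀ s, ξ (ξ s) = s) ∧ ∀ s, ξ s ≠ s := by
  simp [perfectMatchings]

theorem perfectMatchings_nonempty {α : Type*} [Fintype α] [DecidableEq α]
    {m : ℕ} (hm : Fintype.card α = 2 * m) : (perfectMatchings α).Nonempty := by
  have hc : Fintype.card α = Fintype.card (Fin m × Bool) := by
    rw [hm, Fintype.card_prod, Fintype.card_fin, Fintype.card_bool, mul_comm]
  let e := Fintype.equivOfCardEq hc
  refine ⟨fun x => e.symm ((e x).1, !(e x).2), mem_perfectMatchings.2 ⟨fun s => by simp, ?_⟩⟩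
  intro s hs
  have := congrArg e hs
  rw [Equiv.apply_symm_apply] at this
  exact Bool.not_ne_self _ (congrArg Prod.snd this)

theorem sum_stubCut_eq_of_card_eq {α : Type*} [Fintype α] [DecidableEq α] (q : ℝ)
    {T T' : Finset α} (hT : T.card = T'.card) :
    ∑ ξ ∈ perfectMatchings α, q ^ stubCut ξ T = ∑ ξ ∈ perfectMatchings α, q ^ stubCut ξ T' := by
  have hc : Fintype.card {x // x ∈ T} = Fintype.card {x // x ∈ T'} := by simpa using hT
  let e := Fintype.equivOfCardEq hc
  let π : Equiv.Perm α := e.extendSubtype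
  have hπ : ∀ x, π x ∈ T' ↔ x ∈ T := fun x =>
    ⟨fun hx => by_contra fun hx' => e.extendSubtype_not_mem x hx' hx,
      fun hx => e.extendSubtype_mem x hx⟩
  have hπ' : ∀ x, x ∈ T' ↔ π.symm x ∈ T := fun x => by rw [← hπ, Equiv.apply_symm_apply]
  refine Finset.sum_nbij' (fun ξ => π ∘ ξ ∘ π.symm) (fun ξ => π.symm ∘ ξ ∘ π) ?_ ?_ ?_ ?_ ?_
  · intro ξ hξ
    obtain ⟨h1, h2⟩ := mem_perfectMatchings.1 hξ
    refine mem_perfectMatchings.2 ⟨fun s => by simp [h1], fun s hs => ?_⟩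
    exact h2 (π.symm s) (by simpa using congrArg π.symm hs)
  · intro ξ hξ
    obtain ⟨h1, h2⟩ := mem_perfectMatchings.1 hξ
    refine mem_perfectMatchings.2 ⟨fun s => by simp [h1], fun s hs => ?_⟩
    exact h2 (π s) (by simpa using congrArg π hs)
  · intro ξ _; ext x; simp
  · intro ξ _; ext x; simp
  · intro ξ _
    congr 1
    refine Finset.card_nbij' π π.symm ?_ ?_ (fun x _ => by simp) (fun x _ => by simp)
    · intro x hx
      simp only [Finset.coe_filter, Set.mem_ofPred_eq, Function.comp, hπ, Equiv.symm_apply_apply] at hx ⊢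
      exact hx
    · intro x hx
      simp only [Finset.coe_filter, Set.mem_ofPred_eq, Function.comp, hπ, hπ' x] at hx ⊢
      exact hx

theorem choose_mul_sum_pow_stubCut_le {α : Type*} [Fintype α] [DecidableEq α]
    {q : ℝ} (hq0 : 0 ≤ q) (hq1 : q ≤ 1) {m : ℕ} (hm : Fintype.card α = 2 * m) (T : Finset α) :
    ((2 * m).choose T.card : ℝ) * ∑ ξ ∈ perfectMatchings α, q ^ stubCut ξ T ≤
      (perfectMatchings α).card * (2 + 2 * q) ^ m := by
  calc ((2 * m).choose T.card : ℝ) * ∑ ξ ∈ perfectMatchings α, q ^ stubCut ξ T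
      = ∑ T' ∈ Finset.powersetCard T.card Finset.univ,
          ∑ ξ ∈ perfectMatchings α, q ^ stubCut ξ T' := by
        rw [Finset.sum_congr rfl fun T' hT' =>
          sum_stubCut_eq_of_card_eq q (Finset.mem_powersetCard.1 hT').2, Finset.sum_const,
          Finset.card_powersetCard, Finset.card_univ, hm, nsmul_eq_mul]
    _ = ∑ ξ ∈ perfectMatchings α, ∑ T' ∈ Finset.powersetCard T.card Finset.univ,
          q ^ stubCut ξ T' := Finset.sum_comm
    _ ≤ ∑ _ξ ∈ perfectMatchings α, (2 + 2 * q) ^ m := by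
        refine Finset.sum_le_sum fun ξ hξ => ?_
        obtain ⟨h1, h2⟩ := mem_perfectMatchings.1 hξ
        exact (Finset.sum_le_sum_of_subset_of_nonneg (Finset.subset_univ _)
          fun _ _ _ => pow_nonneg hq0 _).trans (sum_pow_stubCut_le ξ h1 h2 hq0 hq1 hm)
    _ = _ := by rw [Finset.sum_const, nsmul_eq_mul]

theorem choose_pow_le_choose_mul (n k r : ℕ) : n.choose k ^ r ≤ (r * n).choose (r * k) := by
  induction r with
  | zero => simp
  | succ r ih =>
    rw [pow_succ, add_mul, add_mul, one_mul, one_mul, Nat.add_choose_eq]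
    refine (Nat.mul_le_mul_right _ ih).trans ?_
    have hmem : (r * k, k) ∈ Finset.HasAntidiagonal.antidiagonal (r * k + k) := by simp
    exact Finset.single_le_sum (f := fun ij : ℕ × ℕ => (r * n).choose ij.1 * n.choose ij.2)
      (fun _ _ => Nat.zero_le _) hmem

theorem two_pow_le_succ_mul_choose_half (n : ℕ) : 2 ^ n ≤ (n + 1) * n.choose (n / 2) := by
  rw [← Nat.sum_range_choose]
  refine (Finset.sum_le_card_nsmul _ _ _ fun k _ => Nat.choose_le_middle k n).trans ?_
  simp

theorem two_pow_mul_le_choose (n r : ℕ) :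
    2 ^ (r * n) ≤ (n + 1) ^ r * (r * n).choose (r * (n / 2)) := by
  calc 2 ^ (r * n) = (2 ^ n) ^ r := by rw [← pow_mul, mul_comm]
    _ ≤ ((n + 1) * n.choose (n / 2)) ^ r :=
        Nat.pow_le_pow_left (two_pow_le_succ_mul_choose_half n) r
    _ ≤ _ := by
        rw [mul_pow]
        exact Nat.mul_le_mul_left _ (choose_pow_le_choose_mul _ _ _)

theorem stubCut_insert_le {α V : Type*} [Fintype α] [DecidableEq α] [DecidableEq V]
    (p : α → V) (ξ : α → α) (hinv : ∀ x, ξ (ξ x) = x) (r : ℕ)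
    (hr : ∀ v, (Finset.univ.filter fun s => p s = v).card = r) (A : Finset V) (v : V) :
    stubCut ξ (Finset.univ.filter fun s => p s ∈ insert v A) +
        2 * (Finset.univ.filter fun s => (p s ∈ A ∧ p (ξ s) ∉ A) ∧ p (ξ s) = v).card ≤
      stubCut ξ (Finset.univ.filter fun s => p s ∈ A) + r := by
  have h1 : stubCut ξ (Finset.univ.filter fun s => p s ∈ insert v A) ≤
      (Finset.univ.filter fun s => (p s ∈ A ∧ p (ξ s) ∉ A) ∧ p (ξ s) ≠ v).card +
      (Finset.univ.filter fun s => p s = v ∧ p (ξ s) ∉ A).card := by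
    unfold stubCut
    refine (Finset.card_le_card ?_).trans (Finset.card_union_le _ _)
    intro s hs
    simp only [Finset.mem_filter, Finset.mem_univ, true_and, Finset.mem_insert, not_or,
      Finset.mem_union] at hs ⊢
    tauto
  have h2 : stubCut ξ (Finset.univ.filter fun s => p s ∈ A) =
      (Finset.univ.filter fun s => (p s ∈ A ∧ p (ξ s) ∉ A) ∧ p (ξ s) = v).card +
      (Finset.univ.filter fun s => (p s ∈ A ∧ p (ξ s) ∉ A) ∧ p (ξ s) ≠ v).card := by
    rw [← Finset.filter_filter (fun s => p s ∈ A ∧ p (ξ s) ∉ A),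
      ← Finset.filter_filter (fun s => p s ∈ A ∧ p (ξ s) ∉ A),
      Finset.card_filter_add_card_filter_not]
    simp [stubCut, Finset.filter_filter]
  have h3 : (Finset.univ.filter fun s => p s = v ∧ p (ξ s) ∉ A).card +
      (Finset.univ.filter fun s => p s = v ∧ p (ξ s) ∈ A).card = r := by
    rw [← hr v, ← Finset.filter_filter, ← Finset.filter_filter, add_comm,
      Finset.card_filter_add_card_filter_not]
  have h4 : (Finset.univ.filter fun s => (p s ∈ A ∧ p (ξ s) ∉ A) ∧ p (ξ s) = v).card ≤
      (Finset.univ.filter fun s => p s = v ∧ p (ξ s) ∈ A).card := by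
    refine Finset.card_le_card_of_injOn ξ ?_ ?_
    · intro s hs
      simp only [Finset.coe_filter, Finset.mem_univ, true_and, Set.mem_ofPred_eq] at hs ⊢
      exact ⟨hs.2, by rw [hinv]; exact hs.1.1⟩
    · intro s _ t _ hst
      rw [← hinv s, hst, hinv]
  omega

theorem exists_notMem_stubCut_insert_le {α V : Type*} [Fintype α] [DecidableEq α] [Fintype V]
    [DecidableEq V] (p : α → V) (ξ : α → α) (hinv : ∀ x, ξ (ξ x) = x) (r : ℕ)
    (hr : ∀ v, (Finset.univ.filter fun s => p s = v).card = r) (A : Finset V)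
    (hA : A.card < Fintype.card V)
    (hcut : ((Fintype.card V : ℝ) - 1) * stubCut ξ (Finset.univ.filter fun s => p s ∈ A) ≤
      r * A.card * (Fintype.card V - A.card)) :
    ∃ v ∉ A, ((Fintype.card V : ℝ) - 1) *
        stubCut ξ (Finset.univ.filter fun s => p s ∈ insert v A) ≤
      r * (insert v A).card * (Fintype.card V - (insert v A).card) := by
  have hcompl : Aᶜ.card + A.card = Fintype.card V := Finset.card_compl_add_card A
  have hne : Aᶜ.Nonempty := by
    rw [← Finset.card_pos]; omega
  have hsum : stubCut ξ (Finset.univ.filter fun s => p s ∈ A) = ∑ v ∈ Aᶜ,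
      (Finset.univ.filter fun s => (p s ∈ A ∧ p (ξ s) ∉ A) ∧ p (ξ s) = v).card := by
    have := Finset.card_eq_sum_card_fiberwise (f := fun s => p (ξ s))
      (s := Finset.univ.filter fun s => p s ∈ A ∧ p (ξ s) ∉ A) (t := Aᶜ)
      (by intro s hs; simpa using (Finset.mem_filter.1 hs).2.2)
    simp only [Finset.filter_filter] at this
    rw [← this]
    simp [stubCut, Finset.filter_filter]
  obtain ⟨v, hv, hle⟩ := Finset.exists_le_of_sum_le hne
    (f := fun _ => stubCut ξ (Finset.univ.filter fun s => p s ∈ A))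
    (g := fun v => Aᶜ.card *
      (Finset.univ.filter fun s => (p s ∈ A ∧ p (ξ s) ∉ A) ∧ p (ξ s) = v).card)
    (by rw [← Finset.mul_sum, ← hsum]; simp)
  have hvA : v ∉ A := by simpa using hv
  refine ⟨v, hvA, ?_⟩
  have hins := stubCut_insert_le p ξ hinv r hr A v
  rw [Finset.card_insert_of_notMem hvA]
  have hk1 : 1 ≤ Aᶜ.card := Finset.card_pos.2 hne
  rcases hk1.eq_or_lt with hk | hk
  · have huniv : insert v A = Finset.univ := by
      rw [← Finset.card_eq_iff_eq_univ, Finset.card_insert_of_notMem hvA]; omega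
    have hz : stubCut ξ (Finset.univ.filter fun s => p s ∈ insert v A) = 0 := by
      simp [stubCut, huniv]
    have hcard : Fintype.card V = A.card + 1 := by omega
    rw [hz, hcard]
    simp
  · have hn : (Fintype.card V : ℝ) = Aᶜ.card + A.card := by exact_mod_cast hcompl.symm
    have hins' : (stubCut ξ (Finset.univ.filter fun s => p s ∈ insert v A) : ℝ) +
        2 * (Finset.univ.filter fun s => (p s ∈ A ∧ p (ξ s) ∉ A) ∧ p (ξ s) = v).card ≤
        stubCut ξ (Finset.univ.filter fun s => p s ∈ A) + r := by exact_mod_cast hins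
    have hle' : (stubCut ξ (Finset.univ.filter fun s => p s ∈ A) : ℝ) ≤ Aᶜ.card *
        (Finset.univ.filter fun s => (p s ∈ A ∧ p (ξ s) ∉ A) ∧ p (ξ s) = v).card := by
      exact_mod_cast hle
    have hk' : (2 : ℝ) ≤ Aᶜ.card := by exact_mod_cast hk
    have ha : (0 : ℝ) ≤ A.card := Nat.cast_nonneg _
    rw [hn] at hcut ⊢
    push_cast
    generalize (stubCut ξ (Finset.univ.filter fun s => p s ∈ insert v A) : ℝ) = c' at *
    generalize (stubCut ξ (Finset.univ.filter fun s => p s ∈ A) : ℝ) = c at *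
    generalize ((Finset.univ.filter
      fun s => (p s ∈ A ∧ p (ξ s) ∉ A) ∧ p (ξ s) = v).card : ℝ) = b at *
    generalize (Aᶜ.card : ℝ) = k at *
    generalize (A.card : ℝ) = a at *
    have hkpos : 0 < k := by linarith
    refine le_of_mul_le_mul_left ?_ hkpos
    have e1 : (k + a - 1) * (k * c' + 2 * c) ≤ (k + a - 1) * (k * (c + r)) := by
      refine mul_le_mul_of_nonneg_left ?_ (by linarith)
      have := mul_le_mul_of_nonneg_left hins' hkpos.le
      linarith
    have e2 := mul_le_mul_of_nonneg_left hcut (by linarith : 0 ≤ k - 2)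
    linarith

theorem exists_insert_chain_stubCut_le {α V : Type*} [Fintype α] [DecidableEq α] [Fintype V]
    [DecidableEq V] (p : α → V) (ξ : α → α) (hinv : ∀ x, ξ (ξ x) = x) (r : ℕ)
    (hr : ∀ v, (Finset.univ.filter fun s => p s = v).card = r) :
    ∃ F : ℕ → Finset V, (∀ a, a < Fintype.card V → ∃ v ∉ F a, F (a + 1) = insert v (F a)) ∧
      ∀ a, a ≤ Fintype.card V → (F a).card = a ∧
        ((Fintype.card V : ℝ) - 1) * stubCut ξ (Finset.univ.filter fun s => p s ∈ F a) ≤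
          r * a * (Fintype.card V - a) := by
  let P : Finset V → Prop := fun A =>
    ((Fintype.card V : ℝ) - 1) * stubCut ξ (Finset.univ.filter fun s => p s ∈ A) ≤
      r * A.card * (Fintype.card V - A.card)
  have hstep : ∀ A : Finset V, ∃ B : Finset V, A.card < Fintype.card V → P A →
      P B ∧ ∃ v ∉ A, B = insert v A := by
    intro A
    by_cases hA : A.card < Fintype.card V ∧ P A
    · obtain ⟨v, hv, hP⟩ := exists_notMem_stubCut_insert_le p ξ hinv r hr A hA.1 hA.2
      exact ⟨insert v A, fun _ _ => ⟨hP, v, hv, rfl⟩⟩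
    · exact ⟨A, fun h1 h2 => absurd ⟨h1, h2⟩ hA⟩
  choose next hnext using hstep
  let F : ℕ → Finset V := fun a => next^[a] ∅
  have hsucc : ∀ a, F (a + 1) = next (F a) := fun a => Function.iterate_succ_apply' _ _ _
  have hF : ∀ a, a ≤ Fintype.card V → (F a).card = a ∧ P (F a) := by
    intro a
    induction a with
    | zero => intro _; simp [F, P, stubCut]
    | succ a ih =>
      intro ha
      obtain ⟨hcard, hP⟩ := ih (by omega)
      obtain ⟨hP', v, hv, hB⟩ := hnext (F a) (by omega) hP
      rw [hsucc]
      refine ⟨?_, hP'⟩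
      rw [hB, Finset.card_insert_of_notMem hv, hcard]
  refine ⟨F, fun a ha => ?_, fun a ha => ?_⟩
  · obtain ⟨hcard, hP⟩ := hF a ha.le
    rw [hsucc]
    exact (hnext (F a) (by omega) hP).2
  · obtain ⟨hcard, hP⟩ := hF a ha
    refine ⟨hcard, ?_⟩
    simpa only [P, hcard] using hP

theorem isFlipStep_insert {V : Type*} [DecidableEq V] {A : Finset V} {v : V} (hv : v ∉ A) :
    IsFlipStep (fun w => decide (w ∈ A)) (fun w => decide (w ∈ insert v A)) := by
  refine ⟨v, funext fun w => ?_⟩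
  by_cases hw : w = v
  · subst hw; simp [hv]
  · simp [hw]

/-- The set whose infimum is the communication height between the constant configurations. -/
def pathMaxima {V : Type*} [Fintype V] [DecidableEq V] (H : (V → Bool) → ℝ) : Set ℝ :=
  { M : ℝ | ∃ (k : ℕ) (γ : Fin (k+1) → (V → Bool)),
    γ 0 = (fun _ => false) ∧ γ (Fin.last k) = (fun _ => true) ∧
    (∀ i : Fin k, IsFlipStep (γ i.castSucc) (γ i.succ)) ∧
    M = Finset.univ.sup' ⟨0, Finset.mem_univ 0⟩ (fun i => H (γ i)) }

theorem gammaStar_eq_sInf_pathMaxima {V : Type*} [Fintype V] [DecidableEq V]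
    (H : (V → Bool) → ℝ) : gammaStar H = sInf (pathMaxima H) - H (fun _ => false) := rfl

theorem exists_mem_pathMaxima_le {V : Type*} [Fintype V] [DecidableEq V] (H : (V → Bool) → ℝ)
    (F : ℕ → Finset V)
    (hstep : ∀ a, a < Fintype.card V → ∃ v ∉ F a, F (a + 1) = insert v (F a))
    (hcard : ∀ a, a ≤ Fintype.card V → (F a).card = a) (B : ℝ)
    (hB : ∀ a, a ≤ Fintype.card V → H (fun w => decide (w ∈ F a)) ≤ B) :
    ∃ M ∈ pathMaxima H, M ≤ B := by
  refine ⟨_, ⟨Fintype.card V, fun i w => decide (w ∈ F i), ?_, ?_, ?_, rfl⟩, ?_⟩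
  · have h0 : F 0 = ∅ := Finset.card_eq_zero.1 (hcard 0 (Nat.zero_le _))
    simp [h0]
  · have h1 : F (Fintype.card V) = Finset.univ :=
      (Finset.card_eq_iff_eq_univ _).1 (hcard _ le_rfl)
    simp [h1]
  · intro i
    obtain ⟨v, hv, hins⟩ := hstep i i.2
    simp only [Fin.val_succ, Fin.val_castSucc, hins]
    exact isFlipStep_insert hv
  · exact Finset.sup'_le _ _ fun i _ => hB i (Nat.lt_succ_iff.1 i.2)

theorem gammaStar_le_of_chain {V : Type*} [Fintype V] [DecidableEq V] (H : (V → Bool) → ℝ)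
    (F : ℕ → Finset V)
    (hstep : ∀ a, a < Fintype.card V → ∃ v ∉ F a, F (a + 1) = insert v (F a))
    (hcard : ∀ a, a ≤ Fintype.card V → (F a).card = a) (B : ℝ)
    (hB : ∀ a, a ≤ Fintype.card V →
      H (fun w => decide (w ∈ F a)) - H (fun _ => false) ≤ B) :
    gammaStar H ≤ B := by
  obtain ⟨M, hM, hMB⟩ := exists_mem_pathMaxima_le H F hstep hcard (B + H (fun _ => false))
    fun a ha => by linarith [hB a ha]
  have hbdd : BddBelow (pathMaxima H) := by
    refine ⟨H (fun _ => false), ?_⟩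
    rintro M ⟨k, γ, h0, -, -, rfl⟩
    rw [← h0]
    exact Finset.le_sup' (fun i => H (γ i)) (Finset.mem_univ 0)
  rw [gammaStar_eq_sInf_pathMaxima]
  linarith [csInf_le hbdd hM]

theorem exists_card_eq_of_path {V : Type*} [Fintype V] [DecidableEq V] {k : ℕ}
    (γ : Fin (k + 1) → (V → Bool)) (h0 : γ 0 = fun _ => false)
    (h1 : γ (Fin.last k) = fun _ => true)
    (hstep : ∀ i : Fin k, IsFlipStep (γ i.castSucc) (γ i.succ)) {m : ℕ}
    (hm : m ≤ Fintype.card V) :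
    ∃ i, (Finset.univ.filter fun v => γ i v = true).card = m := by
  have key : ∀ i : Fin (k + 1), (Finset.univ.filter fun v => γ i v = true).card < m ∨
      ∃ j, (Finset.univ.filter fun v => γ j v = true).card = m := by
    intro i
    induction i using Fin.induction with
    | zero =>
      rcases Nat.eq_zero_or_pos m with rfl | hpos
      · exact Or.inr ⟨0, by simp [h0]⟩
      · exact Or.inl (by simpa [h0] using hpos)
    | succ i ih =>
      rcases ih with ih | ih
      · obtain ⟨v, hv⟩ := hstep i
        have hle : (Finset.univ.filter fun w => γ i.succ w = true).card ≤
            (Finset.univ.filter fun w => γ i.castSucc w = true).card + 1 := by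
          refine (Finset.card_le_card (t := insert v
            (Finset.univ.filter fun w => γ i.castSucc w = true)) ?_).trans
            (Finset.card_insert_le _ _)
          intro w hw
          by_cases hwv : w = v
          · simp [hwv]
          · simpa [hv, hwv] using hw
        rcases (show (Finset.univ.filter fun w => γ i.succ w = true).card < m ∨
          (Finset.univ.filter fun w => γ i.succ w = true).card = m by omega) with h | h
        · exact Or.inl h
        · exact Or.inr ⟨_, h⟩
      · exact Or.inr ih
  rcases key (Fin.last k) with h | h
  · simp [h1] at h
    omega
  · exact h

theorem le_gammaStar_of_forall_card_eq {V : Type*} [Fintype V] [DecidableEq V]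
    (H : (V → Bool) → ℝ) (hne : (pathMaxima H).Nonempty) {m : ℕ} (hm : m ≤ Fintype.card V)
    (B : ℝ) (hB : ∀ σ : V → Bool, (Finset.univ.filter fun v => σ v = true).card = m →
      B ≤ H σ - H (fun _ => false)) :
    B ≤ gammaStar H := by
  have : B + H (fun _ => false) ≤ sInf (pathMaxima H) := by
    refine le_csInf hne ?_
    rintro M ⟨k, γ, h0, h1, hstep, rfl⟩
    obtain ⟨i, hi⟩ := exists_card_eq_of_path γ h0 h1 hstep hm
    have := Finset.le_sup' (fun i => H (γ i)) (Finset.mem_univ i)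
    linarith [hB (γ i) hi]
  rw [gammaStar_eq_sInf_pathMaxima]
  linarith

theorem cmHamiltonian_sub_eq (n r : ℕ) (J h : ℝ)
    (ξ : (Σ _ : Fin n, Fin r) → (Σ _ : Fin n, Fin r)) (hinv : ∀ s, ξ (ξ s) = s)
    (σ : Fin n → Bool) :
    cmHamiltonian n (fun _ => r) J h ξ σ - cmHamiltonian n (fun _ => r) J h ξ (fun _ => false) =
      J * stubCut ξ (Finset.univ.filter fun s => s.1 ∈ Finset.univ.filter fun v => σ v = true) -
        h * (Finset.univ.filter fun v => σ v = true).card := by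
  have hcut : ∑ s : Σ _ : Fin n, Fin r, (1 - spin (σ s.1) * spin (σ (ξ s).1)) =
      4 * (stubCut ξ
        (Finset.univ.filter fun s => s.1 ∈ Finset.univ.filter fun v => σ v = true) : ℝ) := by
    have hc : (stubCut ξ
        (Finset.univ.filter fun s => s.1 ∈ Finset.univ.filter fun v => σ v = true) : ℝ) =
        ∑ s : Σ _ : Fin n, Fin r, if σ s.1 = true ∧ σ (ξ s).1 ≠ true then 1 else 0 := by
      rw [Finset.sum_boole]
      simp [stubCut, Finset.filter_filter]
    have hsymm : ∑ s : Σ _ : Fin n, Fin r, (if σ s.1 = true ∧ σ (ξ s).1 ≠ true then (1 : ℝ) else 0)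
        = ∑ s : Σ _ : Fin n, Fin r, if σ (ξ s).1 = true ∧ σ s.1 ≠ true then 1 else 0 := by
      refine Finset.sum_nbij' ξ ξ (by simp) (by simp) (by simp [hinv]) (by simp [hinv]) ?_
      intro s _
      rw [hinv]
    have htwo : ∑ s : Σ _ : Fin n, Fin r, (1 - spin (σ s.1) * spin (σ (ξ s).1)) =
        2 * ∑ s : Σ _ : Fin n, Fin r, (if σ s.1 = true ∧ σ (ξ s).1 ≠ true then (1 : ℝ) else 0) +
        2 * ∑ s : Σ _ : Fin n, Fin r, if σ (ξ s).1 = true ∧ σ s.1 ≠ true then 1 else 0 := by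
      rw [Finset.mul_sum, Finset.mul_sum, ← Finset.sum_add_distrib]
      refine Finset.sum_congr rfl fun s _ => ?_
      cases σ s.1 <;> cases σ (ξ s).1 <;> norm_num [spin]
    rw [htwo, ← hsymm, ← hc]
    ring
  have hspin : ∑ v, (spin (σ v) + 1) =
      2 * ((Finset.univ.filter fun v => σ v = true).card : ℝ) := by
    rw [Finset.card_filter, Nat.cast_sum, Finset.mul_sum]
    refine Finset.sum_congr rfl fun v _ => ?_
    cases σ v <;> norm_num [spin]
  have hf : spin false = -1 := by simp [spin]
  rw [Finset.sum_sub_distrib] at hcut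
  rw [Finset.sum_add_distrib] at hspin
  unfold cmHamiltonian
  simp only [hf]
  simp only [Finset.sum_const, nsmul_eq_mul, mul_one] at hcut hspin ⊢
  linear_combination (J / 4) * hcut - (h / 2) * hspin

theorem card_filter_exists_stubCut_lt_le {α V : Type*} [Fintype α] [DecidableEq α] [Fintype V]
    [DecidableEq V] (p : α → V) {q : ℝ} (hq0 : 0 < q) (hq1 : q ≤ 1) {m t k : ℕ}
    (hm : Fintype.card α = 2 * m)
    (ht : ∀ A : Finset V, A.card = k → (Finset.univ.filter fun s => p s ∈ A).card = t) (K : ℝ)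
    (bad : Finset (α → α)) (hbad : bad ⊆ perfectMatchings α)
    (hK : ∀ ξ ∈ bad, ∃ A : Finset V, A.card = k ∧
      (stubCut ξ (Finset.univ.filter fun s => p s ∈ A) : ℝ) < K) :
    ((2 * m).choose t : ℝ) * q ^ K * bad.card ≤
      2 ^ Fintype.card V * ((perfectMatchings α).card * (2 + 2 * q) ^ m) := by
  have hqK : 0 < q ^ K := Real.rpow_pos_of_pos hq0 K
  have h1 : q ^ K * bad.card ≤ ∑ A ∈ Finset.powersetCard k (Finset.univ : Finset V),
      ∑ ξ ∈ perfectMatchings α, q ^ stubCut ξ (Finset.univ.filter fun s => p s ∈ A) := by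
    rw [Finset.sum_comm, mul_comm, ← nsmul_eq_mul, ← Finset.sum_const]
    refine (Finset.sum_le_sum fun ξ hξ => ?_).trans
      (Finset.sum_le_sum_of_subset_of_nonneg hbad fun ξ _ _ =>
        Finset.sum_nonneg fun A _ => (pow_pos hq0 _).le)
    obtain ⟨A, hA, hcut⟩ := hK ξ hξ
    calc q ^ K ≤ q ^ stubCut ξ (Finset.univ.filter fun s => p s ∈ A) := by
          rw [← Real.rpow_natCast]
          exact Real.rpow_le_rpow_of_exponent_ge hq0 hq1 hcut.le
      _ ≤ _ := Finset.single_le_sum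
          (f := fun A => q ^ stubCut ξ (Finset.univ.filter fun s => p s ∈ A))
          (fun A _ => (pow_pos hq0 _).le)
          (Finset.mem_powersetCard.2 ⟨Finset.subset_univ _, hA⟩)
  calc ((2 * m).choose t : ℝ) * q ^ K * bad.card
      ≤ (2 * m).choose t * ∑ A ∈ Finset.powersetCard k (Finset.univ : Finset V),
        ∑ ξ ∈ perfectMatchings α, q ^ stubCut ξ (Finset.univ.filter fun s => p s ∈ A) := by
        rw [mul_assoc]
        exact mul_le_mul_of_nonneg_left h1 (Nat.cast_nonneg _)
    _ ≤ ∑ _A ∈ Finset.powersetCard k (Finset.univ : Finset V),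
          ((perfectMatchings α).card * (2 + 2 * q) ^ m : ℝ) := by
        rw [Finset.mul_sum]
        refine Finset.sum_le_sum fun A hA => ?_
        rw [← ht A (Finset.mem_powersetCard.1 hA).2]
        exact choose_mul_sum_pow_stubCut_le hq0.le hq1 hm _
    _ ≤ _ := by
        rw [Finset.sum_const, nsmul_eq_mul]
        refine mul_le_mul_of_nonneg_right ?_ (by positivity)
        have := Finset.card_le_card (Finset.subset_univ (Finset.powersetCard k (Finset.univ : Finset V)))
        rw [Finset.card_univ, Fintype.card_finset] at this
        exact_mod_cast this

/-- The exponential growth rate, per stub, of the expected number of bisections of a random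
`r`-regular graph with cut proportion `y`. -/
noncomputable def bisectionRate (r : ℝ) (y : ℝ) : ℝ :=
  (1 / r - 1) * Real.log 2 + Real.negMulLog y + Real.negMulLog (1 / 2 - y)

theorem one_lt_iff_bisectionRate_pos (r : ℝ) {y : ℝ} (hy0 : 0 < y) (hy : y < 1 / 2) :
    1 < (1 / 2 : ℝ) ^ ((1 / 2 : ℝ) * (1 - 1 / r)) *
        (1 - 1 / 2 : ℝ) ^ ((1 - 1 / 2 : ℝ) * (1 - 1 / r)) *
        (1 - 1 / 2 - y) ^ (-(1 - 1 / 2 - y) / 2) * (1 / 2 - y) ^ (-(1 / 2 - y) / 2) * y ^ (-y) ↔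
      0 < bisectionRate r y := by
  have h2 : (1 - 1 / 2 : ℝ) = 1 / 2 := by norm_num
  have hy' : 0 < 1 / 2 - y := by linarith
  have hhalf : (0 : ℝ) < 1 / 2 := by norm_num
  rw [h2, Real.rpow_def_of_pos hhalf, Real.rpow_def_of_pos hy', Real.rpow_def_of_pos hy0,
    ← Real.exp_add, ← Real.exp_add, ← Real.exp_add, ← Real.exp_add, Real.one_lt_exp_iff]
  have hl : Real.log (1 / 2) = -Real.log 2 := by rw [one_div, Real.log_inv]
  rw [hl, bisectionRate, Real.negMulLog, Real.negMulLog]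
  ring_nf

theorem exists_bisectionRate_neg {r : ℝ} (hr : 1 < r) {ε : ℝ} (hε : 0 < ε)
    (hI : ε ≤ Idelta r (1 / 2)) :
    ∃ y, Idelta r (1 / 2) - ε ≤ y ∧ 0 < y ∧ y < 1 / 4 ∧ bisectionRate r y < 0 := by
  have hlb : ∀ y, 0 < y → y < 1 / 2 → 0 < bisectionRate r y → Idelta r (1 / 2) ≤ y := by
    intro y hy0 hy hpos
    exact csInf_le ⟨0, fun z hz => hz.1.le⟩
      ⟨hy0, hy.le, (one_lt_iff_bisectionRate_pos r hy0 hy).2 hpos⟩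
  have hlog2 : 0 < Real.log 2 := Real.log_pos (by norm_num)
  have hI4 : Idelta r (1 / 2) ≤ 1 / 4 := by
    refine hlb _ (by norm_num) (by norm_num) ?_
    have hl : Real.log (1 / 4) = -(2 * Real.log 2) := by
      rw [one_div, Real.log_inv, show (4 : ℝ) = 2 ^ 2 by norm_num, Real.log_pow]; norm_num
    have h4 : (1 / 2 - 1 / 4 : ℝ) = 1 / 4 := by norm_num
    rw [bisectionRate, h4, Real.negMulLog, hl]
    have : 0 < 1 / r * Real.log 2 := by positivity
    linarith
  set I := Idelta r (1 / 2)
  have hle : ∀ y, 0 < y → y < I → bisectionRate r y ≤ 0 := by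
    intro y hy0 hy
    by_contra hpos
    exact absurd (hlb y hy0 (by linarith) (not_le.1 hpos)) (not_le.2 hy)
  by_contra! hcon
  have ha := hcon (I - 2 * ε / 3) (by linarith) (by linarith) (by linarith)
  have hb := hcon (I - ε / 3) (by linarith) (by linarith) (by linarith)
  have hmid := hle (I - ε / 2) (by linarith) (by linarith)
  have c1 := Real.strictConcaveOn_negMulLog.2 (x := I - 2 * ε / 3) (y := I - ε / 3)
    (Set.mem_Ici.2 (by linarith)) (Set.mem_Ici.2 (by linarith))
    (by intro he; linarith) (by norm_num : (0 : ℝ) < 1 / 2) (by norm_num : (0 : ℝ) < 1 / 2)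
    (by norm_num)
  have c2 := Real.strictConcaveOn_negMulLog.2 (x := 1 / 2 - (I - 2 * ε / 3))
    (y := 1 / 2 - (I - ε / 3)) (Set.mem_Ici.2 (by linarith)) (Set.mem_Ici.2 (by linarith))
    (by intro he; linarith) (by norm_num : (0 : ℝ) < 1 / 2) (by norm_num : (0 : ℝ) < 1 / 2)
    (by norm_num)
  simp only [smul_eq_mul] at c1 c2
  have e1 : 1 / 2 * (I - 2 * ε / 3) + 1 / 2 * (I - ε / 3) = I - ε / 2 := by ring
  have e2 : 1 / 2 * (1 / 2 - (I - 2 * ε / 3)) + 1 / 2 * (1 / 2 - (I - ε / 3)) =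
    1 / 2 - (I - ε / 2) := by ring
  rw [e1] at c1
  rw [e2] at c2
  unfold bisectionRate at ha hb hmid
  linarith

theorem bisectionRate_mul_eq {r n y q m : ℝ} (hr : r ≠ 0) (hy0 : 0 < y) (hy : y < 1 / 2)
    (hq : q = y / (1 / 2 - y)) (hm : 2 * m = r * n) :
    n * Real.log 2 + m * Real.log (2 + 2 * q) - (r * y * n) * Real.log q - r * n * Real.log 2 =
      n * (r * bisectionRate r y) := by
  have hy' : 0 < 1 / 2 - y := by linarith
  have h1 : 2 + 2 * q = 1 / (1 / 2 - y) := by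
    rw [hq, eq_div_iff hy'.ne', add_mul, mul_assoc, div_mul_cancel₀ _ hy'.ne']; ring
  have hm' : m = r * n / 2 := by linarith
  rw [h1, hq, one_div, Real.log_inv, Real.log_div hy0.ne' hy'.ne', bisectionRate,
    Real.negMulLog, Real.negMulLog, hm']
  field_simp
  ring

theorem card_stubs_filter_mem (n r : ℕ) (A : Finset (Fin n)) :
    (Finset.univ.filter fun s : Σ _ : Fin n, Fin r => s.1 ∈ A).card = r * A.card := by
  have : (Finset.univ.filter fun s : Σ _ : Fin n, Fin r => s.1 ∈ A) =
      A.sigma fun _ => Finset.univ := by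
    ext s; simp
  rw [this, Finset.card_sigma]
  simp [mul_comm]

theorem card_stubs_filter_eq (n r : ℕ) (v : Fin n) :
    (Finset.univ.filter fun s : Σ _ : Fin n, Fin r => s.1 = v).card = r := by
  have := card_stubs_filter_mem n r {v}
  simpa using this

theorem card_bad_matchings_le {n r m : ℕ} (hr : 0 < r) (hm : r * n = 2 * m) {y : ℝ}
    (hy0 : 0 < y) (hy : y < 1 / 4) (bad : Finset ((Σ _ : Fin n, Fin r) → (Σ _ : Fin n, Fin r)))
    (hbad : bad ⊆ perfectMatchings _)
    (hK : ∀ ξ ∈ bad, ∃ A : Finset (Fin n), A.card = n / 2 ∧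
      (stubCut ξ (Finset.univ.filter fun s => s.1 ∈ A) : ℝ) < r * y * n) :
    (bad.card : ℝ) ≤ (n + 1) ^ r * Real.exp (r * bisectionRate r y) ^ n *
      (perfectMatchings (Σ _ : Fin n, Fin r)).card := by
  have hy' : 0 < 1 / 2 - y := by linarith
  obtain ⟨q, hq⟩ : ∃ q, q = y / (1 / 2 - y) := ⟨_, rfl⟩
  have hq0 : 0 < q := by rw [hq]; positivity
  have hq1 : q ≤ 1 := by rw [hq, div_le_one hy']; linarith
  have hcard : Fintype.card (Σ _ : Fin n, Fin r) = 2 * m := by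
    rw [← hm]; simp [mul_comm]
  have h1 := card_filter_exists_stubCut_lt_le (fun s : Σ _ : Fin n, Fin r => s.1) hq0 hq1 hcard
    (t := r * (n / 2)) (k := n / 2) (fun A hA => by rw [card_stubs_filter_mem, hA])
    (r * y * n) bad hbad hK
  have h2 : (2 : ℝ) ^ (r * n) ≤ (n + 1) ^ r * (2 * m).choose (r * (n / 2)) := by
    rw [← hm]; exact_mod_cast two_pow_mul_le_choose n r
  rw [Fintype.card_fin] at h1
  have hqK : 0 < q ^ (r * y * n : ℝ) := Real.rpow_pos_of_pos hq0 _
  have hb : (0 : ℝ) ≤ bad.card := Nat.cast_nonneg _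
  have hM : (0 : ℝ) ≤ (perfectMatchings (Σ _ : Fin n, Fin r)).card := Nat.cast_nonneg _
  have h3 : (2 : ℝ) ^ (r * n) * q ^ (r * y * n : ℝ) * bad.card ≤ (n + 1) ^ r *
      (2 ^ n * ((perfectMatchings (Σ _ : Fin n, Fin r)).card * (2 + 2 * q) ^ m)) := by
    calc (2 : ℝ) ^ (r * n) * q ^ (r * y * n : ℝ) * bad.card
        ≤ ((n + 1) ^ r * (2 * m).choose (r * (n / 2))) * q ^ (r * y * n : ℝ) * bad.card := by
          gcongr
      _ = (n + 1) ^ r * ((2 * m).choose (r * (n / 2)) * q ^ (r * y * n : ℝ) * bad.card) := by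
          ring
      _ ≤ _ := mul_le_mul_of_nonneg_left h1 (by positivity)
  have h4 : (2 : ℝ) ^ n * (2 + 2 * q) ^ m =
      2 ^ (r * n) * q ^ (r * y * n : ℝ) * Real.exp (r * bisectionRate r y) ^ n := by
    have hrate := bisectionRate_mul_eq (r := r) (n := n) (m := m) (by positivity) hy0
      (by linarith) hq (by exact_mod_cast hm.symm)
    have hp : ∀ (x : ℝ) (k : ℕ), 0 < x → x ^ k = Real.exp (k * Real.log x) := fun x k hx => by
      rw [Real.exp_nat_mul, Real.exp_log hx]
    rw [hp 2 n two_pos, hp (2 + 2 * q) m (by linarith), hp 2 (r * n) two_pos,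
      Real.rpow_def_of_pos hq0, ← Real.exp_nat_mul, ← Real.exp_add, ← Real.exp_add,
      ← Real.exp_add]
    congr 1
    push_cast
    linarith
  have h5 : 0 < (2 : ℝ) ^ (r * n) * q ^ (r * y * n : ℝ) := by positivity
  refine le_of_mul_le_mul_left (h3.trans (le_of_eq ?_)) h5
  calc _ = (n + 1 : ℝ) ^ r * (perfectMatchings (Σ _ : Fin n, Fin r)).card *
        (2 ^ n * (2 + 2 * q) ^ m) := by ring
    _ = _ := by rw [h4]; ring

theorem exists_forall_succ_pow_mul_pow_le (r : ℕ) {ρ : ℝ} (h0 : 0 < ρ) (h1 : ρ < 1) {δ : ℝ}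
    (hδ : 0 < δ) : ∃ N : ℕ, ∀ n : ℕ, N ≤ n → ((n : ℝ) + 1) ^ r * ρ ^ n ≤ δ := by
  have ht := tendsto_pow_const_mul_const_pow_of_lt_one r h0.le h1
  obtain ⟨N, hN⟩ := Filter.eventually_atTop.1 (ht.eventually_le_const (mul_pos hδ h0))
  refine ⟨N, fun n hn => ?_⟩
  have := hN (n + 1) (by omega)
  push_cast at this
  rw [pow_succ ρ, ← mul_assoc] at this
  exact le_of_mul_le_mul_right this h0

theorem exists_cut_density {r : ℕ} (hr : 2 ≤ r) {ε δ : ℝ} (hε : 0 < ε) (hδ : 0 < δ) :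
    ∃ y, Idelta r (1 / 2) - ε ≤ y ∧ ∃ N : ℕ, ∀ n, N ≤ n → Even (r * n) →
      ∀ bad ⊆ perfectMatchings (Σ _ : Fin n, Fin r),
        (∀ ξ ∈ bad, ∃ A : Finset (Fin n), A.card = n / 2 ∧
          (stubCut ξ (Finset.univ.filter fun s => s.1 ∈ A) : ℝ) < r * y * n) →
        (bad.card : ℝ) ≤ δ * (perfectMatchings (Σ _ : Fin n, Fin r)).card := by
  by_cases hI : ε ≤ Idelta r (1 / 2)
  · obtain ⟨y, hyI, hy0, hy, hneg⟩ :=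
      exists_bisectionRate_neg (r := r) (by exact_mod_cast hr) hε hI
    have hr0 : (0 : ℝ) < r := by exact_mod_cast (by omega : 0 < r)
    obtain ⟨N, hN⟩ := exists_forall_succ_pow_mul_pow_le r (Real.exp_pos (r * bisectionRate r y))
      (Real.exp_lt_one_iff.2 (mul_neg_of_pos_of_neg hr0 hneg)) hδ
    refine ⟨y, hyI, N, fun n hn heven bad hbad hK => ?_⟩
    obtain ⟨m, hm⟩ := heven
    refine (card_bad_matchings_le (by omega) (by omega : r * n = 2 * m) hy0 hy bad hbad hK).trans ?_
    exact mul_le_mul_of_nonneg_right (hN n hn) (Nat.cast_nonneg _)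
  · refine ⟨0, by linarith, 0, fun n _ _ bad _ hK => ?_⟩
    have : bad = ∅ := by
      refine Finset.eq_empty_of_forall_notMem fun ξ hξ => ?_
      obtain ⟨A, -, hA⟩ := hK ξ hξ
      have : (0 : ℝ) ≤ stubCut ξ (Finset.univ.filter fun s => s.1 ∈ A) := Nat.cast_nonneg _
      linarith
    rw [this]
    simp only [Finset.card_empty, Nat.cast_zero]
    positivity

theorem cmHamiltonian_finset_sub_eq (n r : ℕ) (J h : ℝ)
    (ξ : (Σ _ : Fin n, Fin r) → (Σ _ : Fin n, Fin r)) (hinv : ∀ s, ξ (ξ s) = s)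
    (A : Finset (Fin n)) :
    cmHamiltonian n (fun _ => r) J h ξ (fun w => decide (w ∈ A)) -
        cmHamiltonian n (fun _ => r) J h ξ (fun _ => false) =
      J * stubCut ξ (Finset.univ.filter fun s => s.1 ∈ A) - h * A.card := by
  rw [cmHamiltonian_sub_eq n r J h ξ hinv]
  simp

theorem energy_profile_le {Q h n a c J r : ℝ} (hQ : Q = J * r) (hJ : 0 < J) (hQ0 : 0 < Q)
    (hh : 0 < h) (hhQ : h < Q) (hn : 2 ≤ n) (hc : (n - 1) * c ≤ r * a * (n - a)) :
    J * c - h * a ≤ Q / 4 * (1 - (h / Q) ^ 2) * n + Q / 2 := by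
  obtain ⟨t, ht⟩ : ∃ t, t = h / Q := ⟨_, rfl⟩
  have hht : h = t * Q := by rw [ht]; field_simp
  have ht0 : 0 < t := by rw [ht]; positivity
  have ht1 : t < 1 := by rw [ht, div_lt_one hQ0]; exact hhQ
  rw [← ht]
  have hn0 : 0 < n := by linarith
  have hn1 : 0 < n - 1 := by linarith
  have h1 : (n - 1) * (J * c) ≤ Q * (a * (n - a)) := by
    have := mul_le_mul_of_nonneg_left hc hJ.le
    rw [hQ]; linarith
  have h2 : a * (n - a) ≤ n ^ 2 / 4 := by nlinarith [sq_nonneg (n / 2 - a)]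
  have h3 : J * c ≤ Q * (a * (n - a)) / n + Q / 2 := by
    refine le_of_mul_le_mul_left (h1.trans ?_) hn1
    have e : (n - 1) * (Q * (a * (n - a)) / n + Q / 2) =
        Q * (a * (n - a)) + Q * ((n - 1) / 2 - a * (n - a) / n) := by
      field_simp; ring
    rw [e]
    have h4 : a * (n - a) / n ≤ n / 4 := by
      rw [div_le_iff₀ hn0]; nlinarith
    have : 0 ≤ Q * ((n - 1) / 2 - a * (n - a) / n) := mul_nonneg hQ0.le (by linarith)
    linarith
  have h5 : a * (n - a) / n - t * a ≤ 1 / 4 * (1 - t ^ 2) * n := by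
    rw [sub_le_iff_le_add, div_le_iff₀ hn0]
    nlinarith [sq_nonneg (n * (1 - t) / 2 - a), mul_pos (mul_pos ht0 (sub_pos.2 ht1)) (pow_pos hn0 2)]
  have h6 := mul_le_mul_of_nonneg_left h5 hQ0.le
  rw [hht]
  have e : Q * (a * (n - a)) / n = Q * (a * (n - a) / n) := by ring
  rw [e] at h3
  linarith

theorem gammaStar_cmHamiltonian_bounds {n r : ℕ} (hr : 0 < r) (hn : 2 ≤ n) {J h : ℝ} (hJ : 0 < J)
    (hh : 0 < h) (hhJ : h < J * r) (ξ : (Σ _ : Fin n, Fin r) → (Σ _ : Fin n, Fin r))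
    (hinv : ∀ s, ξ (ξ s) = s) {K : ℝ}
    (hK : ∀ A : Finset (Fin n), A.card = n / 2 →
      K ≤ stubCut ξ (Finset.univ.filter fun s => s.1 ∈ A)) :
    J * K - h / 2 * n ≤ gammaStar (cmHamiltonian n (fun _ => r) J h ξ) ∧
      gammaStar (cmHamiltonian n (fun _ => r) J h ξ) ≤
        J * r / 4 * (1 - (h / (J * r)) ^ 2) * n + J * r / 2 := by
  have hr0 : (0 : ℝ) < r := by exact_mod_cast hr
  have hn2 : (2 : ℝ) ≤ n := by exact_mod_cast hn
  obtain ⟨F, hstep, hF⟩ := exists_insert_chain_stubCut_le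
    (fun s : Σ _ : Fin n, Fin r => s.1) ξ hinv r (card_stubs_filter_eq n r)
  constructor
  · obtain ⟨M, hM, -⟩ := exists_mem_pathMaxima_le (cmHamiltonian n (fun _ => r) J h ξ) F hstep
      (fun a ha => (hF a ha).1)
      ((Finset.range (n + 1)).sup' ⟨0, by simp⟩ fun a =>
        cmHamiltonian n (fun _ => r) J h ξ fun w => decide (w ∈ F a))
      (fun a ha => Finset.le_sup' (fun a =>
        cmHamiltonian n (fun _ => r) J h ξ fun w => decide (w ∈ F a))
        (by simp at ha ⊢; omega))
    refine le_gammaStar_of_forall_card_eq _ ⟨M, hM⟩ (m := n / 2)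
      (by rw [Fintype.card_fin]; omega) _ fun σ hσ => ?_
    rw [cmHamiltonian_sub_eq n r J h ξ hinv, hσ]
    have h1 := mul_le_mul_of_nonneg_left (hK _ hσ) hJ.le
    have h2 : ((n / 2 : ℕ) : ℝ) ≤ n / 2 := Nat.cast_div_le
    have h3 := mul_le_mul_of_nonneg_left h2 hh.le
    linarith
  · refine gammaStar_le_of_chain _ F hstep (fun a ha => (hF a ha).1) _ fun a ha => ?_
    rw [cmHamiltonian_finset_sub_eq n r J h ξ hinv, (hF a ha).1]
    have hc := (hF a ha).2
    rw [Fintype.card_fin] at hc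
    exact energy_profile_le rfl hJ (mul_pos hJ hr0) hh hhJ hn2 hc

open Classical in
/-- Fix an integer `r ≥ 3`, `J > 0` and `0 < h < J·r`. For every `ε > 0`, as
`n → ∞` along integers for which `r·n` is even, the energy barrier of the
Configuration Model with constant degree sequence `d_i = r` satisfies
`P[J·r·I_r(1/2)·n − (h/2)·n − ε·n ≤ Γ*_n ≤ (J·r/4)·(1 − (h/(J·r))²)·n + ε·n] → 1`. -/
theorem stmt14 (r : ℕ) (hr : 3 ≤ r) (J h : ℝ) (hJ : 0 < J) (hh : 0 < h)
    (hhJ : h < J * r) :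
    ∀ ε : ℝ, 0 < ε → ∀ δ : ℝ, 0 < δ → ∃ N : ℕ, ∀ n, N ≤ n → Even (r * n) →
      1 - δ ≤
        (((cmMatchings n (fun _ => r)).filter (fun ξ =>
            J * r * Idelta (r : ℝ) (1/2) * n - (h/2) * n - ε * n
                ≤ gammaStar (cmHamiltonian n (fun _ => r) J h ξ) ∧
            gammaStar (cmHamiltonian n (fun _ => r) J h ξ)
                ≤ (J * r / 4) * (1 - (h / (J * r)) ^ 2) * n + ε * n)).card : ℝ)
          / ((cmMatchings n (fun _ => r)).card : ℝ) := by
  intro ε hε δ hδ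
  have hr0 : (0 : ℝ) < r := by exact_mod_cast (by omega : 0 < r)
  have hQ : 0 < J * r := mul_pos hJ hr0
  obtain ⟨y, hy, N, hN⟩ := exists_cut_density (r := r) (by omega) (div_pos hε hQ) hδ
  refine ⟨max (max N 2) ⌈J * r / 2 / ε⌉₊, fun n hn heven => ?_⟩
  have hn1 : N ≤ n := (le_max_left _ _).trans ((le_max_left _ _).trans hn)
  have hn2 : 2 ≤ n := (le_max_right _ _).trans ((le_max_left _ _).trans hn)
  have hn3 : J * r / 2 ≤ ε * n := by
    have := Nat.ceil_le.1 ((le_max_right _ _).trans hn)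
    rw [div_le_iff₀ hε] at this
    linarith
  have hM : cmMatchings n (fun _ => r) = perfectMatchings (Σ _ : Fin n, Fin r) := by
    ext ξ
    simp [cmMatchings, mem_perfectMatchings]
  have hpos : 0 < ((cmMatchings n (fun _ => r)).card : ℝ) := by
    obtain ⟨m, hm⟩ := heven
    rw [hM, Nat.cast_pos, Finset.card_pos]
    refine perfectMatchings_nonempty (m := m) ?_
    simp only [Fintype.card_sigma, Fintype.card_fin, Finset.sum_const, Finset.card_univ,
      smul_eq_mul]
    rw [mul_comm]
    omega
  let bad := (cmMatchings n (fun _ => r)).filter fun ξ => ∃ A : Finset (Fin n),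
    A.card = n / 2 ∧ (stubCut ξ (Finset.univ.filter fun s => s.1 ∈ A) : ℝ) < r * y * n
  have hbad : (bad.card : ℝ) ≤ δ * (cmMatchings n (fun _ => r)).card := by
    rw [hM]
    refine hN n hn1 heven bad ?_ fun ξ hξ => (Finset.mem_filter.1 hξ).2
    rw [← hM]
    exact Finset.filter_subset _ _
  have hcover : cmMatchings n (fun _ => r) ⊆
      (cmMatchings n (fun _ => r)).filter (fun ξ =>
            J * r * Idelta (r : ℝ) (1/2) * n - (h/2) * n - ε * n
                ≤ gammaStar (cmHamiltonian n (fun _ => r) J h ξ) ∧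
            gammaStar (cmHamiltonian n (fun _ => r) J h ξ)
                ≤ (J * r / 4) * (1 - (h / (J * r)) ^ 2) * n + ε * n) ∪ bad := by
    intro ξ hξ
    by_cases hξb : ξ ∈ bad
    · exact Finset.mem_union_right _ hξb
    · refine Finset.mem_union_left _ (Finset.mem_filter.2 ⟨hξ, ?_⟩)
      have hinv := (mem_perfectMatchings.1 (hM ▸ hξ)).1
      have hK : ∀ A : Finset (Fin n), A.card = n / 2 →
          r * y * n ≤ stubCut ξ (Finset.univ.filter fun s => s.1 ∈ A) := by
        intro A hA
        by_contra hlt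
        exact hξb (Finset.mem_filter.2 ⟨hξ, A, hA, not_le.1 hlt⟩)
      obtain ⟨hlow, hup⟩ :=
        gammaStar_cmHamiltonian_bounds (by omega) hn2 hJ hh hhJ ξ hinv hK
      refine ⟨le_trans ?_ hlow, by linarith⟩
      have h1 : J * r * (Idelta r (1 / 2) - ε / (J * r)) * n ≤ J * r * y * n := by
        gcongr
      have h2 : J * r * (Idelta r (1 / 2) - ε / (J * r)) = J * r * Idelta r (1 / 2) - ε := by
        field_simp
      rw [h2] at h1
      linarith
  have hcard := (Finset.card_le_card hcover).trans (Finset.card_union_le _ _)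
  rw [le_div_iff₀ hpos]
  have hcard' := (Nat.cast_le (α := ℝ)).2 hcard
  push_cast at hcard'
  linarith
end
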